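/- arXiv:2401.13353 — 2 statements merged into one kernel-verified Lean document; each statement's English description precedes it below -/
import Mathlib

section
/- For every p > 2 there exists a constant C_p > 0 such that for all sufficiently large N ∈ ℕ there exists a set S_N ⊆ {1,…,N} with card(S_N) ≥ (4pN)^{2/p} and ‖S_N‖_{Λ(p)} ≤ C_p. Moreover, when p = 2m for an integer m ≥ 2, there is a constant g ≥ 1 depending only on m such that S_N can additionally be taken to be a B_m^*[g] set. -/
open Set MeasureTheory
open scoped BigOperators Real

noncomputable section

/-- The trigonometric polynomial `x ↦ Σ_{n} a_n e^{2πinx}` attached to a finitely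
supported sequence `a : ℤ →₀ ℂ`. -/
def expSum (a : ℤ →₀ ℂ) (t : ℝ) : ℂ :=
  ∑ n ∈ a.support, a n * Complex.exp (2 * Real.pi * Complex.I * (n : ℂ) * (t : ℂ))

/-- `A` satisfies the `Λ(p)` bound with constant `C`:
`‖Σ_{n∈A} a_n e^{2πinx}‖_{L^p([0,1])} ≤ C (Σ |a_n|²)^{1/2}` for every finitely supported
sequence `a` supported in `A`.  (Thus `‖A‖_{Λ(p)} ≤ C`.) -/
def HasLambdaBound (A : Set ℤ) (p C : ℝ) : Prop :=
  ∀ a : ℤ →₀ ℂ, (∀ n : ℤ, n ∉ A → a n = 0) →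
    (∫ t in Set.Icc (0 : ℝ) 1, ‖expSum a t‖ ^ p) ^ (1 / p) ≤
      C * (∑ n ∈ a.support, ‖a n‖ ^ 2) ^ (1 / 2 : ℝ)

/-- `A ⊆ ℤ` is a `B_m^*[g]` set: for every `n`, the number of `m`-tuples
`(a₁, …, a_m) ∈ A^m` with `a₁ + ⋯ + a_m = n` is at most `g`. -/
def IsBmStarZ (m g : ℕ) (A : Set ℤ) : Prop :=
  ∀ n : ℤ, Set.ncard {t : Fin m → ℤ | (∀ i, t i ∈ A) ∧ ∑ i, t i = n} ≤ g

/-- The derivative of the truncated power `truncPow`. -/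
def truncWeight (α Q s : ℝ) : ℝ := (min (1 + s) Q) ^ α

/-- A convex function of `s ≥ 0` comparable to `s ^ (1 + α)` for `1 ≤ s ≤ Q`, growing linearly
beyond `Q`. -/
def truncPow (α Q s : ℝ) : ℝ := ∫ r in (0 : ℝ)..s, truncWeight α Q r

section TruncPow

variable {α Q : ℝ}

lemma continuous_truncWeight (hα : 0 ≤ α) : Continuous (truncWeight α Q) := by
  unfold truncWeight
  exact Continuous.rpow_const (by fun_prop) (fun _ => Or.inr hα)

lemma continuous_truncPow (hα : 0 ≤ α) : Continuous (truncPow α Q) :=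
  intervalIntegral.continuous_primitive
    (fun a b => (continuous_truncWeight hα).intervalIntegrable a b) 0

lemma truncWeight_mono (hα : 0 ≤ α) (hQ : 1 ≤ Q) {a b : ℝ} (ha : 0 ≤ a) (hab : a ≤ b) :
    truncWeight α Q a ≤ truncWeight α Q b := by
  unfold truncWeight
  refine Real.rpow_le_rpow (le_min (by linarith) (by linarith)) ?_ hα
  exact min_le_min (by linarith) le_rfl

lemma one_le_truncWeight (hα : 0 ≤ α) (hQ : 1 ≤ Q) {a : ℝ} (ha : 0 ≤ a) :
    1 ≤ truncWeight α Q a :=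
  Real.one_le_rpow (le_min (by linarith) hQ) hα

lemma truncWeight_le (hα : 0 ≤ α) (hQ : 1 ≤ Q) {a : ℝ} (ha : 0 ≤ a) :
    truncWeight α Q a ≤ Q ^ α :=
  Real.rpow_le_rpow (le_min (by linarith) (by linarith)) (min_le_right _ _) hα

lemma truncPow_sub (hα : 0 ≤ α) (a b : ℝ) :
    truncPow α Q b - truncPow α Q a = ∫ r in a..b, truncWeight α Q r :=
  intervalIntegral.integral_interval_sub_left
    ((continuous_truncWeight hα).intervalIntegrable _ _)
    ((continuous_truncWeight hα).intervalIntegrable _ _)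

lemma truncPow_sub_bounds (hα : 0 ≤ α) (hQ : 1 ≤ Q) {a b : ℝ} (ha : 0 ≤ a) (hab : a ≤ b) :
    (b - a) * truncWeight α Q a ≤ truncPow α Q b - truncPow α Q a ∧
      truncPow α Q b - truncPow α Q a ≤ (b - a) * truncWeight α Q b := by
  rw [truncPow_sub hα]
  have hc := (continuous_truncWeight (Q := Q) hα).intervalIntegrable (μ := volume) a b
  constructor
  · have := intervalIntegral.integral_mono_on hab
      (intervalIntegrable_const (c := truncWeight α Q a)) hc
      (fun x hx => truncWeight_mono hα hQ ha hx.1)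
    simpa using this
  · have := intervalIntegral.integral_mono_on hab hc
      (intervalIntegrable_const (c := truncWeight α Q b))
      (fun x hx => truncWeight_mono hα hQ (ha.trans hx.1) hx.2)
    simpa using this

lemma truncPow_subgradient (hα : 0 ≤ α) (hQ : 1 ≤ Q) {a b : ℝ} (ha : 0 ≤ a) (hb : 0 ≤ b) :
    truncPow α Q a + (b - a) * truncWeight α Q a ≤ truncPow α Q b := by
  rcases le_total a b with h | h
  · linarith [(truncPow_sub_bounds hα hQ ha h).1]
  · linarith [(truncPow_sub_bounds hα hQ hb h).2]

lemma truncPow_zero : truncPow α Q 0 = 0 := by simp [truncPow]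

lemma truncPow_nonneg (hα : 0 ≤ α) (hQ : 1 ≤ Q) {s : ℝ} (hs : 0 ≤ s) : 0 ≤ truncPow α Q s := by
  have := truncPow_subgradient hα hQ le_rfl hs
  rw [truncPow_zero] at this
  have h1 := one_le_truncWeight hα hQ (le_refl (0 : ℝ))
  nlinarith

lemma mul_truncWeight_le (hα : 0 ≤ α) (hQ : 1 ≤ Q) {s : ℝ} (hs : 0 ≤ s) :
    s * truncWeight α Q s ≤ 2 ^ (1 + α) * truncPow α Q s := by
  have h1 : truncWeight α Q s ≤ 2 ^ α * truncWeight α Q (s / 2) := by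
    unfold truncWeight
    rw [← Real.mul_rpow (by norm_num) (le_min (by linarith) (by linarith))]
    refine Real.rpow_le_rpow (le_min (by linarith) (by linarith)) ?_ hα
    rw [mul_min_of_nonneg _ _ (by norm_num : (0 : ℝ) ≤ 2)]
    exact min_le_min (by linarith) (by linarith)
  have h2 := (truncPow_sub_bounds hα hQ (by linarith : (0 : ℝ) ≤ s / 2)
    (by linarith : s / 2 ≤ s)).1
  have h3 := truncPow_nonneg hα hQ (by linarith : (0 : ℝ) ≤ s / 2)
  have h4 : (2 : ℝ) ^ (1 + α) = 2 * 2 ^ α := by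
    rw [Real.rpow_add (by norm_num), Real.rpow_one]
  have h5 : (0 : ℝ) < 2 ^ α := by positivity
  rw [h4]
  calc s * truncWeight α Q s ≤ s * (2 ^ α * truncWeight α Q (s / 2)) := by gcongr
    _ = 2 * 2 ^ α * ((s - s / 2) * truncWeight α Q (s / 2)) := by ring
    _ ≤ 2 * 2 ^ α * truncPow α Q s := by gcongr; linarith

lemma truncWeight_le_truncPow (hα : 0 ≤ α) (hQ : 1 ≤ Q) {s : ℝ} (hs : 0 ≤ s) :
    truncWeight α Q s ≤ 2 ^ (1 + α) * (1 + truncPow α Q s) := by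
  have h0 := truncPow_nonneg hα hQ hs
  have h5 : (0 : ℝ) < 2 ^ (1 + α) := by positivity
  rcases le_total s 1 with h | h
  · have : truncWeight α Q s ≤ 2 ^ (1 + α) := by
      unfold truncWeight
      calc (min (1 + s) Q) ^ α ≤ 2 ^ α :=
            Real.rpow_le_rpow (le_min (by linarith) (by linarith))
              ((min_le_left _ _).trans (by linarith)) hα
        _ ≤ 2 ^ (1 + α) := Real.rpow_le_rpow_of_exponent_le (by norm_num) (by linarith)
    nlinarith
  · have h1 := mul_truncWeight_le hα hQ hs
    have h2 := one_le_truncWeight hα hQ hs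
    nlinarith

lemma mul_truncWeight_sq_le (hα : 0 ≤ α) (hQ : 1 ≤ Q) {s : ℝ} (hs : 0 ≤ s) :
    s * truncWeight α Q s ^ 2 ≤ Q ^ α * 2 ^ (1 + α) * truncPow α Q s := by
  have h1 := mul_truncWeight_le hα hQ hs
  have h2 := truncWeight_le hα hQ hs
  have h3 := one_le_truncWeight hα hQ hs
  have h4 : 0 ≤ s * truncWeight α Q s := by positivity
  calc s * truncWeight α Q s ^ 2 = truncWeight α Q s * (s * truncWeight α Q s) := by ring
    _ ≤ Q ^ α * (2 ^ (1 + α) * truncPow α Q s) := by gcongr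
    _ = _ := by ring

lemma truncWeight_sub_le (hα : 0 ≤ α) (hQ : 1 ≤ Q) {r s : ℝ} (hr : 0 ≤ r) (hrs : r ≤ s) :
    (truncWeight α Q s - truncWeight α Q r) * (1 + s) ≤
      max α 1 * (s - r) * truncWeight α Q s := by
  set m := min (1 + s) Q with hm
  set l := min (1 + r) Q with hl
  have hmpos : 0 < m := lt_min (by linarith) (by linarith)
  have hlpos : 0 < l := lt_min (by linarith) (by linarith)
  have hlm : l ≤ m := min_le_min (by linarith) le_rfl
  have hx : 1 - (l / m) ^ α ≤ max α 1 * (1 - l / m) := by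
    have hx0 : 0 < l / m := by positivity
    have hx1 : l / m ≤ 1 := (div_le_one hmpos).2 hlm
    rcases le_total α 1 with h | h
    · rw [max_eq_right h]
      have : (l / m) ^ (1 : ℝ) ≤ (l / m) ^ α := Real.rpow_le_rpow_of_exponent_ge hx0 hx1 h
      rw [Real.rpow_one] at this
      linarith
    · rw [max_eq_left h]
      have := one_add_mul_self_le_rpow_one_add (s := l / m - 1) (by linarith) h
      rw [add_sub_cancel] at this
      linarith
  have hfrac : (1 - l / m) * (1 + s) ≤ s - r := by
    have : (1 + r) / (1 + s) ≤ l / m := by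
      rw [div_le_div_iff₀ (by linarith) hmpos]
      rcases le_total (1 + r) Q with h | h
      · rw [hl, min_eq_left h]
        exact mul_le_mul_of_nonneg_left (min_le_left _ _) (by linarith)
      · rw [hl, hm, min_eq_right h, min_eq_right (by linarith)]
        nlinarith
    rw [div_le_iff₀ (by linarith)] at this
    nlinarith
  have e1 : truncWeight α Q r = (l / m) ^ α * truncWeight α Q s := by
    unfold truncWeight
    rw [Real.div_rpow hlpos.le hmpos.le, ← hm, ← hl,
      div_mul_cancel₀ _ (Real.rpow_pos_of_pos hmpos α).ne']
  have hs1 := one_le_truncWeight hα hQ (hr.trans hrs)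
  rw [e1]
  calc (truncWeight α Q s - (l / m) ^ α * truncWeight α Q s) * (1 + s)
      = (1 - (l / m) ^ α) * ((1 + s) * truncWeight α Q s) := by ring
    _ ≤ max α 1 * (1 - l / m) * ((1 + s) * truncWeight α Q s) := by
        gcongr
        have : 0 ≤ s := hr.trans hrs
        positivity
    _ = max α 1 * ((1 - l / m) * (1 + s)) * truncWeight α Q s := by ring
    _ ≤ max α 1 * (s - r) * truncWeight α Q s := by gcongr

/-- The second-order constant of `truncPow_norm_add_sq_le`. -/
def truncConst (α : ℝ) : ℝ := 1 + 64 * (max α 1 * 8 ^ α)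

lemma truncWeight_diff_le (hα : 0 ≤ α) (hQ : 1 ≤ Q) {r s : ℝ} (hr : 0 ≤ r) (hs : 0 ≤ s)
    (hrs : 1 + r ≤ 8 * (1 + s)) :
    (r - s) * (truncWeight α Q r - truncWeight α Q s) * (1 + s) ≤
      8 * (max α 1 * 8 ^ α) * (r - s) ^ 2 * truncWeight α Q s := by
  have hA : 1 ≤ max α 1 := le_max_right _ _
  have h8 : (1 : ℝ) ≤ 8 ^ α := Real.one_le_rpow (by norm_num) hα
  have ht := one_le_truncWeight hα hQ hs
  rcases le_total r s with h | h
  · have h1 := truncWeight_sub_le hα hQ hr h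
    calc (r - s) * (truncWeight α Q r - truncWeight α Q s) * (1 + s)
        = (s - r) * ((truncWeight α Q s - truncWeight α Q r) * (1 + s)) := by ring
      _ ≤ (s - r) * (max α 1 * (s - r) * truncWeight α Q s) := by gcongr
      _ = max α 1 * ((r - s) ^ 2 * truncWeight α Q s) := by ring
      _ ≤ (8 * (max α 1 * 8 ^ α)) * ((r - s) ^ 2 * truncWeight α Q s) := by
          gcongr
          nlinarith
      _ = _ := by ring
  · have h1 := truncWeight_sub_le hα hQ hs h
    have h2 : truncWeight α Q r ≤ 8 ^ α * truncWeight α Q s := by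
      unfold truncWeight
      rw [← Real.mul_rpow (by norm_num) (le_min (by linarith) (by linarith))]
      refine Real.rpow_le_rpow (le_min (by linarith) (by linarith)) ?_ hα
      rw [mul_min_of_nonneg _ _ (by norm_num : (0 : ℝ) ≤ 8)]
      exact min_le_min (by linarith) (by linarith)
    have h3 := truncWeight_mono hα hQ hs h
    calc (r - s) * (truncWeight α Q r - truncWeight α Q s) * (1 + s)
        ≤ (r - s) * ((truncWeight α Q r - truncWeight α Q s) * (1 + r)) := by
          rw [mul_assoc]
          gcongr
      _ ≤ (r - s) * (max α 1 * (r - s) * truncWeight α Q r) := by gcongr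
      _ ≤ (r - s) * (max α 1 * (r - s) * (8 ^ α * truncWeight α Q s)) := by
          have : 0 ≤ r - s := by linarith
          gcongr
      _ = 1 * (max α 1 * 8 ^ α) * ((r - s) ^ 2 * truncWeight α Q s) := by ring
      _ ≤ 8 * (max α 1 * 8 ^ α) * ((r - s) ^ 2 * truncWeight α Q s) := by
          gcongr; norm_num
      _ = _ := by ring

lemma norm_add_sq_complex (z h : ℂ) :
    ‖z + h‖ ^ 2 = ‖z‖ ^ 2 + (2 * (h * starRingEnd ℂ z).re + ‖h‖ ^ 2) := by
  rw [← Complex.normSq_eq_norm_sq, ← Complex.normSq_eq_norm_sq, ← Complex.normSq_eq_norm_sq]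
  simp only [Complex.normSq_apply, Complex.add_re, Complex.add_im, Complex.mul_re, Complex.conj_re,
    Complex.conj_im]
  ring

lemma truncPow_norm_add_sq_le (hα : 0 ≤ α) (hQ : 1 ≤ Q) (z h : ℂ) (hh : ‖h‖ ≤ 1) :
    truncPow α Q (‖z + h‖ ^ 2) ≤ truncPow α Q (‖z‖ ^ 2) +
      2 * (h * starRingEnd ℂ z).re * truncWeight α Q (‖z‖ ^ 2) +
      truncConst α * ‖h‖ ^ 2 * truncWeight α Q (‖z‖ ^ 2) := by
  set s := ‖z‖ ^ 2 with hs
  set r := ‖z + h‖ ^ 2 with hr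
  have hs0 : 0 ≤ s := by positivity
  have hr0 : 0 ≤ r := by positivity
  have hd : r - s = 2 * (h * starRingEnd ℂ z).re + ‖h‖ ^ 2 := by
    rw [hr, hs, norm_add_sq_complex]; ring
  have hre : |(h * starRingEnd ℂ z).re| ≤ ‖h‖ * ‖z‖ := by
    refine (Complex.abs_re_le_norm _).trans ?_
    rw [norm_mul, Complex.norm_conj]
  have hh0 := norm_nonneg h
  have hz0 := norm_nonneg z
  have habs : |r - s| ≤ ‖h‖ * (2 * ‖z‖ + 1) := by
    rw [hd]
    calc |2 * (h * starRingEnd ℂ z).re + ‖h‖ ^ 2|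
        ≤ |2 * (h * starRingEnd ℂ z).re| + |‖h‖ ^ 2| := abs_add_le _ _
      _ = 2 * |(h * starRingEnd ℂ z).re| + ‖h‖ ^ 2 := by
          rw [abs_mul, abs_of_nonneg (by positivity : 0 ≤ ‖h‖ ^ 2)]; norm_num
      _ ≤ ‖h‖ * (2 * ‖z‖ + 1) := by nlinarith
  have hsq : (r - s) ^ 2 ≤ 8 * ‖h‖ ^ 2 * (1 + s) := by
    have h1 : (r - s) ^ 2 ≤ (‖h‖ * (2 * ‖z‖ + 1)) ^ 2 := by
      rw [← sq_abs (r - s)]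
      gcongr
    have h2 : (2 * ‖z‖ + 1) ^ 2 ≤ 8 * (1 + s) := by
      rw [hs]; nlinarith [sq_nonneg (2 * ‖z‖ - 1)]
    calc (r - s) ^ 2 ≤ ‖h‖ ^ 2 * (2 * ‖z‖ + 1) ^ 2 := by rw [← mul_pow]; exact h1
      _ ≤ ‖h‖ ^ 2 * (8 * (1 + s)) := by gcongr
      _ = _ := by ring
  have hr8 : 1 + r ≤ 8 * (1 + s) := by
    have : r ≤ (‖z‖ + 1) ^ 2 := by
      rw [hr]; gcongr; exact (norm_add_le _ _).trans (by linarith)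
    rw [hs]; nlinarith [sq_nonneg (‖z‖ - 1)]
  have hdiff := truncWeight_diff_le hα hQ hr0 hs0 hr8
  have ht := one_le_truncWeight hα hQ hs0
  have hA : 0 ≤ max α 1 * 8 ^ α := by positivity
  have hdiff' : (r - s) * (truncWeight α Q r - truncWeight α Q s) ≤
      64 * (max α 1 * 8 ^ α) * ‖h‖ ^ 2 * truncWeight α Q s := by
    refine le_of_mul_le_mul_right (hdiff.trans ?_) (by linarith : 0 < 1 + s)
    calc 8 * (max α 1 * 8 ^ α) * (r - s) ^ 2 * truncWeight α Q s
        ≤ 8 * (max α 1 * 8 ^ α) * (8 * ‖h‖ ^ 2 * (1 + s)) * truncWeight α Q s := by gcongr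
      _ = _ := by ring
  have hsub := truncPow_subgradient hα hQ hr0 hs0
  have : truncPow α Q r ≤ truncPow α Q s + (r - s) * truncWeight α Q s +
      (r - s) * (truncWeight α Q r - truncWeight α Q s) := by linarith
  rw [hd] at this
  rw [hd] at hdiff'
  unfold truncConst
  nlinarith

end TruncPow

/-- Lebesgue measure on the unit interval. -/
abbrev unitMeasure : Measure ℝ := volume.restrict (Set.Icc (0 : ℝ) 1)

/-- The character `x ↦ e^{2πinx}`. -/
def fexp (n : ℤ) (x : ℝ) : ℂ := Complex.exp (2 * Real.pi * Complex.I * (n : ℂ) * (x : ℂ))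

/-- The `n`-th Fourier coefficient of a function on the unit interval. -/
def fcoef (g : ℝ → ℂ) (n : ℤ) : ℂ := ∫ x, g x * starRingEnd ℂ (fexp n x) ∂unitMeasure

/-- The trigonometric polynomial with coefficients `a` and frequencies in `S`. -/
def trig (a : ℤ → ℂ) (S : Finset ℤ) (x : ℝ) : ℂ := ∑ n ∈ S, a n * fexp n x

section Fourier

instance : IsProbabilityMeasure unitMeasure := ⟨by simp⟩

lemma integrable_unit_of_continuous {E : Type*} [NormedAddCommGroup E] {f : ℝ → E}
    (hf : Continuous f) : Integrable f unitMeasure := hf.integrableOn_Icc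

@[fun_prop]
lemma continuous_fexp (n : ℤ) : Continuous (fexp n) := by unfold fexp; fun_prop

@[fun_prop]
lemma continuous_trig (a : ℤ → ℂ) (S : Finset ℤ) : Continuous (trig a S) := by
  unfold trig; fun_prop

lemma norm_fexp (n : ℤ) (x : ℝ) : ‖fexp n x‖ = 1 := by
  have : 2 * (Real.pi : ℂ) * Complex.I * (n : ℂ) * (x : ℂ) =
      ((2 * Real.pi * n * x : ℝ) : ℂ) * Complex.I := by push_cast; ring
  rw [fexp, this, Complex.norm_exp_ofReal_mul_I]

lemma conj_fexp (n : ℤ) (x : ℝ) : starRingEnd ℂ (fexp n x) = fexp (-n) x := by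
  unfold fexp
  rw [← Complex.exp_conj]
  congr 1
  simp [map_ofNat]

lemma fexp_mul (n m : ℤ) (x : ℝ) : fexp n x * fexp m x = fexp (n + m) x := by
  unfold fexp
  rw [← Complex.exp_add]
  congr 1
  push_cast
  ring

lemma fexp_sub_right (n : ℤ) (x y : ℝ) :
    fexp n (x - y) = fexp n x * starRingEnd ℂ (fexp n y) := by
  rw [conj_fexp]
  unfold fexp
  rw [← Complex.exp_add]
  congr 1
  push_cast
  ring

lemma fexp_add_intCast (n k : ℤ) (x : ℝ) : fexp n (x + k) = fexp n x := by
  unfold fexp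
  rw [show 2 * (Real.pi : ℂ) * Complex.I * (n : ℂ) * ((x + k : ℝ) : ℂ) =
    2 * Real.pi * Complex.I * n * x + ((n * k : ℤ) : ℂ) * (2 * Real.pi * Complex.I) by
      push_cast; ring, Complex.exp_periodic.int_mul]

lemma integral_fexp (n : ℤ) : ∫ x, fexp n x ∂unitMeasure = if n = 0 then 1 else 0 := by
  split_ifs with h
  · simp [fexp, h]
  · have hc : 2 * (Real.pi : ℂ) * Complex.I * (n : ℂ) ≠ 0 := by
      simp [Real.pi_ne_zero, h]
    have := integral_exp_mul_complex (a := 0) (b := 1) hc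
    rw [intervalIntegral.integral_of_le zero_le_one, ← integral_Icc_eq_integral_Ioc] at this
    unfold fexp
    rw [this, show 2 * (Real.pi : ℂ) * Complex.I * (n : ℂ) * ((1 : ℝ) : ℂ) =
      (n : ℂ) * (2 * Real.pi * Complex.I) by push_cast; ring, Complex.exp_int_mul_two_pi_mul_I]
    simp

lemma integral_fexp_mul_conj (n m : ℤ) :
    ∫ x, fexp n x * starRingEnd ℂ (fexp m x) ∂unitMeasure = if n = m then 1 else 0 := by
  simp_rw [conj_fexp, fexp_mul]
  rw [integral_fexp]
  simp [add_neg_eq_zero]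

lemma integral_mul_conj_trig {g : ℝ → ℂ} (hg : Continuous g) (a : ℤ → ℂ) (S : Finset ℤ) :
    ∫ x, g x * starRingEnd ℂ (trig a S x) ∂unitMeasure =
      ∑ n ∈ S, starRingEnd ℂ (a n) * fcoef g n := by
  unfold trig fcoef
  simp_rw [map_sum, Finset.mul_sum, map_mul]
  rw [integral_finsetSum]
  · refine Finset.sum_congr rfl fun n _ => ?_
    rw [← integral_const_mul]
    congr 1
    ext x
    ring
  · intro n _
    exact integrable_unit_of_continuous
      (hg.mul (continuous_const.mul (Complex.continuous_conj.comp (continuous_fexp n))))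

lemma fcoef_trig (a : ℤ → ℂ) (S : Finset ℤ) (n : ℤ) :
    fcoef (trig a S) n = if n ∈ S then a n else 0 := by
  unfold fcoef trig
  simp_rw [Finset.sum_mul]
  rw [integral_finsetSum]
  · simp_rw [mul_assoc, integral_const_mul, integral_fexp_mul_conj]
    simp
  · intro m _
    exact integrable_unit_of_continuous
      ((continuous_const.mul (continuous_fexp m)).mul
        (Complex.continuous_conj.comp (continuous_fexp n)))

lemma integral_norm_sq_eq {g : ℝ → ℂ} :
    ((∫ x, ‖g x‖ ^ 2 ∂unitMeasure : ℝ) : ℂ) =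
      ∫ x, g x * starRingEnd ℂ (g x) ∂unitMeasure := by
  rw [← integral_complex_ofReal]
  congr 1
  ext x
  rw [Complex.mul_conj, Complex.normSq_eq_norm_sq]

lemma integral_norm_trig_sq (a : ℤ → ℂ) (S : Finset ℤ) :
    ∫ x, ‖trig a S x‖ ^ 2 ∂unitMeasure = ∑ n ∈ S, ‖a n‖ ^ 2 := by
  have h : ((∫ x, ‖trig a S x‖ ^ 2 ∂unitMeasure : ℝ) : ℂ) =
      ((∑ n ∈ S, ‖a n‖ ^ 2 : ℝ) : ℂ) := by
    rw [integral_norm_sq_eq, integral_mul_conj_trig (continuous_trig a S)]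
    push_cast
    refine Finset.sum_congr rfl fun n hn => ?_
    rw [fcoef_trig, if_pos hn, Complex.conj_mul']
  exact_mod_cast h

lemma integral_re_mul_conj {g h : ℝ → ℂ} (hg : Continuous g) (hh : Continuous h) :
    ∫ x, (g x * starRingEnd ℂ (h x)).re ∂unitMeasure =
      (∫ x, g x * starRingEnd ℂ (h x) ∂unitMeasure).re :=
  integral_re (𝕜 := ℂ) (integrable_unit_of_continuous
    (hg.mul (Complex.continuous_conj.comp hh)))

lemma sum_norm_fcoef_sq_le {g : ℝ → ℂ} (hg : Continuous g) (T : Finset ℤ) :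
    ∑ n ∈ T, ‖fcoef g n‖ ^ 2 ≤ ∫ x, ‖g x‖ ^ 2 ∂unitMeasure := by
  set h := trig (fcoef g) T with hh
  have hc : Continuous h := continuous_trig _ _
  have h1 : ∫ x, ‖g x - h x‖ ^ 2 ∂unitMeasure = ∫ x, ‖g x‖ ^ 2 ∂unitMeasure -
      2 * ∫ x, (g x * starRingEnd ℂ (h x)).re ∂unitMeasure + ∫ x, ‖h x‖ ^ 2 ∂unitMeasure := by
    rw [← integral_const_mul, ← integral_sub, ← integral_add]
    · congr 1
      ext x
      rw [sub_eq_add_neg, norm_add_sq_complex, norm_neg]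
      simp only [Complex.mul_re, Complex.neg_re, Complex.conj_re, Complex.neg_im, Complex.conj_im]
      ring
    all_goals
      refine integrable_unit_of_continuous ?_
      have := Complex.continuous_conj
      fun_prop
  rw [integral_re_mul_conj hg hc, hh, integral_mul_conj_trig hg, integral_norm_trig_sq] at h1
  have h2 : (∑ n ∈ T, starRingEnd ℂ (fcoef g n) * fcoef g n).re = ∑ n ∈ T, ‖fcoef g n‖ ^ 2 := by
    rw [Complex.re_sum]
    refine Finset.sum_congr rfl fun n _ => ?_
    rw [Complex.conj_mul', ← Complex.ofReal_pow, Complex.ofReal_re]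
  rw [h2] at h1
  have h3 : 0 ≤ ∫ x, ‖g x - h x‖ ^ 2 ∂unitMeasure := integral_nonneg fun x => by positivity
  linarith

lemma sum_mul_norm_fcoef_sq_le {g : ℝ → ℂ} (hg : Continuous g) (T : Finset ℤ) (c : ℤ → ℝ)
    {B : ℝ} (hB : ∀ x, ‖∑ n ∈ T, (c n : ℂ) * fexp n x‖ ≤ B) :
    ∑ n ∈ T, c n * ‖fcoef g n‖ ^ 2 ≤ B * (∫ x, ‖g x‖ ∂unitMeasure) ^ 2 := by
  set k := trig (fun n => c n * fcoef g n) T with hk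
  have hkc : Continuous k := continuous_trig _ _
  have hkB : ∀ x, ‖k x‖ ≤ B * ∫ x, ‖g x‖ ∂unitMeasure := by
    intro x
    have : k x = ∫ y, g y * ∑ n ∈ T, (c n : ℂ) * fexp n (x - y) ∂unitMeasure := by
      simp_rw [Finset.mul_sum]
      rw [integral_finsetSum]
      · rw [hk, trig]
        refine Finset.sum_congr rfl fun n _ => ?_
        rw [fcoef, ← integral_const_mul, ← integral_mul_const]
        congr 1
        ext y
        rw [fexp_sub_right]
        ring
      · intro n _
        refine integrable_unit_of_continuous ?_
        fun_prop
    rw [this]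
    refine (norm_integral_le_integral_norm _).trans ?_
    rw [← integral_const_mul]
    refine integral_mono (integrable_unit_of_continuous ?_) (integrable_unit_of_continuous ?_) ?_
    · fun_prop
    · fun_prop
    · intro y
      simp only [norm_mul]
      rw [mul_comm]
      exact mul_le_mul_of_nonneg_right (hB _) (norm_nonneg _)
  have h1 : ((∑ n ∈ T, c n * ‖fcoef g n‖ ^ 2 : ℝ) : ℂ) =
      ∫ x, g x * starRingEnd ℂ (k x) ∂unitMeasure := by
    rw [hk, integral_mul_conj_trig hg]
    push_cast
    refine Finset.sum_congr rfl fun n _ => ?_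
    rw [map_mul, mul_assoc, Complex.conj_mul', Complex.conj_ofReal]
  have h2 : ‖((∑ n ∈ T, c n * ‖fcoef g n‖ ^ 2 : ℝ) : ℂ)‖ ≤
      B * (∫ x, ‖g x‖ ∂unitMeasure) ^ 2 := by
    rw [h1]
    refine (norm_integral_le_integral_norm _).trans ?_
    rw [sq, ← mul_assoc, ← integral_const_mul]
    refine integral_mono (integrable_unit_of_continuous ?_) (integrable_unit_of_continuous ?_) ?_
    · have := Complex.continuous_conj
      fun_prop
    · fun_prop
    · intro y
      simp only [norm_mul, Complex.norm_conj]
      rw [mul_comm]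
      exact mul_le_mul_of_nonneg_right (hkB _) (norm_nonneg _)
  exact (le_abs_self _).trans (by rwa [Complex.norm_real] at h2)

lemma sum_norm_fcoef_sq_le_of_kernel {g : ℝ → ℂ} (hg : Continuous g) {S T : Finset ℤ}
    (hST : S ⊆ T) {δ B : ℝ} (hδ : 0 ≤ δ)
    (hB : ∀ x, ‖∑ n ∈ S, fexp n x - δ * ∑ n ∈ T, fexp n x‖ ≤ B) :
    ∑ n ∈ S, ‖fcoef g n‖ ^ 2 ≤
      δ * ∫ x, ‖g x‖ ^ 2 ∂unitMeasure + B * (∫ x, ‖g x‖ ∂unitMeasure) ^ 2 := by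
  have h1 := sum_mul_norm_fcoef_sq_le hg T (fun n => (if n ∈ S then 1 else 0) - δ) (B := B) (by
    intro x
    convert hB x using 2
    simp only [Complex.ofReal_sub, apply_ite Complex.ofReal, Complex.ofReal_one,
      Complex.ofReal_zero, sub_mul, Finset.sum_sub_distrib, ite_mul, one_mul, zero_mul,
      Finset.mul_sum]
    rw [← Finset.sum_filter, Finset.filter_mem_eq_inter, Finset.inter_eq_right.2 hST])
  simp only [sub_mul, Finset.sum_sub_distrib, ite_mul, one_mul, zero_mul, ← Finset.mul_sum] at h1
  rw [← Finset.sum_filter, Finset.filter_mem_eq_inter, Finset.inter_eq_right.2 hST] at h1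
  have h2 := mul_le_mul_of_nonneg_left (sum_norm_fcoef_sq_le hg T) hδ
  linarith

end Fourier

section Tail

/-- The part of `s ^ α` exceeding the truncation of `s` at height `Q`. -/
def excess (α Q s : ℝ) : ℝ := s ^ α - (min s Q) ^ α

lemma continuous_excess {α Q : ℝ} (hα : 0 ≤ α) : Continuous (excess α Q) := by
  unfold excess
  exact (Real.continuous_rpow_const hα).sub
    (Continuous.rpow_const (by fun_prop) (fun _ => Or.inr hα))

lemma excess_nonneg {α Q s : ℝ} (hα : 0 ≤ α) (hQ : 0 ≤ Q) (hs : 0 ≤ s) : 0 ≤ excess α Q s :=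
  sub_nonneg.2 (Real.rpow_le_rpow (le_min hs hQ) (min_le_left _ _) hα)

lemma excess_le {α Q s : ℝ} (hQ : 0 ≤ Q) (hs : 0 ≤ s) : excess α Q s ≤ s ^ α :=
  sub_le_self _ (Real.rpow_nonneg (le_min hs hQ) _)

lemma excess_eq_zero {α Q s : ℝ} (hs : s ≤ Q) : excess α Q s = 0 := by
  rw [excess, min_eq_left hs, sub_self]

lemma integral_mul_excess_le {α Q δ B M : ℝ} (hα : 0 ≤ α) (hQ : 0 < Q) (hδ : 0 ≤ δ)
    (hBQ : B ≤ Q / 2) {S T : Finset ℤ} (hST : S ⊆ T)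
    (hB : ∀ x, ‖∑ n ∈ S, fexp n x - δ * ∑ n ∈ T, fexp n x‖ ≤ B)
    (a : ℤ → ℂ) (ha : ∑ n ∈ S, ‖a n‖ ^ 2 ≤ 1) (hM : ∀ x, ‖trig a S x‖ ^ 2 ≤ M) :
    ∫ x, ‖trig a S x‖ ^ 2 * excess α Q (‖trig a S x‖ ^ 2) ∂unitMeasure ≤ 2 * δ * M ^ α := by
  set f := trig a S with hf
  have hfc : Continuous f := continuous_trig _ _
  set w : ℝ → ℝ := fun x => excess α Q (‖f x‖ ^ 2) with hw
  have hwc : Continuous w := (continuous_excess hα).comp (by fun_prop)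
  have hw0 : ∀ x, 0 ≤ w x := fun x => excess_nonneg hα hQ.le (by positivity)
  have hwM : ∀ x, w x ≤ M ^ α := fun x => (excess_le hQ.le (by positivity)).trans
    (Real.rpow_le_rpow (by positivity) (hM x) hα)
  set G : ℝ → ℂ := fun x => w x * f x with hG
  have hGc : Continuous G := by fun_prop
  set I := ∫ x, ‖f x‖ ^ 2 * w x ∂unitMeasure with hI
  have hI0 : 0 ≤ I := integral_nonneg fun x => mul_nonneg (by positivity) (hw0 x)
  have hM0 : 0 ≤ M ^ α := (hw0 0).trans (hwM 0)
  have hpair : (I : ℂ) = ∑ n ∈ S, starRingEnd ℂ (a n) * fcoef G n := by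
    rw [← integral_mul_conj_trig hGc, ← integral_complex_ofReal]
    congr 1
    ext x
    rw [hG, ← hf, mul_assoc, Complex.mul_conj, Complex.normSq_eq_norm_sq]
    push_cast
    ring
  have hCS : I ^ 2 ≤ ∑ n ∈ S, ‖fcoef G n‖ ^ 2 := by
    have h1 : I ≤ ∑ n ∈ S, ‖a n‖ * ‖fcoef G n‖ := by
      calc I = ‖(I : ℂ)‖ := by rw [Complex.norm_real, Real.norm_of_nonneg hI0]
        _ ≤ ∑ n ∈ S, ‖starRingEnd ℂ (a n) * fcoef G n‖ := by
            rw [hpair]; exact norm_sum_le _ _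
        _ = _ := by simp
    calc I ^ 2 ≤ (∑ n ∈ S, ‖a n‖ * ‖fcoef G n‖) ^ 2 := by gcongr
      _ ≤ (∑ n ∈ S, ‖a n‖ ^ 2) * ∑ n ∈ S, ‖fcoef G n‖ ^ 2 :=
          Finset.sum_mul_sq_le_sq_mul_sq _ _ _
      _ ≤ 1 * ∑ n ∈ S, ‖fcoef G n‖ ^ 2 := by gcongr
      _ = _ := one_mul _
  have hkey := hCS.trans (sum_norm_fcoef_sq_le_of_kernel hGc hST hδ hB)
  have hG2 : ∫ x, ‖G x‖ ^ 2 ∂unitMeasure ≤ M ^ α * I := by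
    rw [hI, ← integral_const_mul]
    refine integral_mono (integrable_unit_of_continuous (by fun_prop))
      (integrable_unit_of_continuous (by fun_prop)) fun x => ?_
    simp only [hG, norm_mul, Complex.norm_real, Real.norm_of_nonneg (hw0 x)]
    calc (w x * ‖f x‖) ^ 2 = w x * (‖f x‖ ^ 2 * w x) := by ring
      _ ≤ M ^ α * (‖f x‖ ^ 2 * w x) := by
          have := hw0 x
          gcongr
          exact hwM x
  have hG1 : √Q * ∫ x, ‖G x‖ ∂unitMeasure ≤ I := by
    rw [hI, ← integral_const_mul]
    refine integral_mono (integrable_unit_of_continuous (by fun_prop))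
      (integrable_unit_of_continuous (by fun_prop)) fun x => ?_
    simp only [hG, norm_mul, Complex.norm_real, Real.norm_of_nonneg (hw0 x)]
    rcases le_or_gt (‖f x‖ ^ 2) Q with h | h
    · have : w x = 0 := excess_eq_zero h
      simp [this]
    · have h1 : √Q ≤ ‖f x‖ := Real.sqrt_le_left (norm_nonneg _) |>.2 h.le
      calc √Q * (w x * ‖f x‖) ≤ ‖f x‖ * (w x * ‖f x‖) := by
            have := hw0 x
            gcongr
        _ = _ := by ring
  have hA0 : 0 ≤ ∫ x, ‖G x‖ ∂unitMeasure := integral_nonneg fun x => norm_nonneg _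
  have hG1' : Q * (∫ x, ‖G x‖ ∂unitMeasure) ^ 2 ≤ I ^ 2 := by
    calc Q * (∫ x, ‖G x‖ ∂unitMeasure) ^ 2 = (√Q * ∫ x, ‖G x‖ ∂unitMeasure) ^ 2 := by
          rw [mul_pow, Real.sq_sqrt hQ.le]
      _ ≤ I ^ 2 := by gcongr
  have h2 : I ^ 2 ≤ δ * (M ^ α * I) + I ^ 2 / 2 := by
    have := mul_le_mul_of_nonneg_left hG2 hδ
    have := mul_le_mul_of_nonneg_right hBQ (sq_nonneg (∫ x, ‖G x‖ ∂unitMeasure))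
    linarith
  by_contra! hcon
  have hpos : 0 < I := lt_of_le_of_lt (by positivity) hcon
  nlinarith

end Tail

/-- The expectation of `f` over the random subset of `T` containing each point independently
with probability `δ`. -/
def subsetExp (δ : ℝ) (T : Finset ℤ) (f : Finset ℤ → ℝ) : ℝ :=
  ∑ S ∈ T.powerset, δ ^ S.card * (1 - δ) ^ (T \ S).card * f S

section RandomSubset

variable {δ : ℝ} {T : Finset ℤ}

lemma subsetExp_mono (h0 : 0 ≤ δ) (h1 : δ ≤ 1) {f g : Finset ℤ → ℝ}
    (hfg : ∀ S, S ⊆ T → f S ≤ g S) : subsetExp δ T f ≤ subsetExp δ T g := by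
  refine Finset.sum_le_sum fun S hS => ?_
  have : 0 ≤ 1 - δ := by linarith
  exact mul_le_mul_of_nonneg_left (hfg S (Finset.mem_powerset.1 hS)) (by positivity)

lemma subsetExp_prod (c d : ℤ → ℝ) :
    subsetExp δ T (fun S => (∏ n ∈ S, c n) * ∏ n ∈ T \ S, d n) =
      ∏ n ∈ T, (δ * c n + (1 - δ) * d n) := by
  rw [Finset.prod_add, subsetExp]
  refine Finset.sum_congr rfl fun S _ => ?_
  rw [Finset.prod_mul_distrib, Finset.prod_mul_distrib, Finset.prod_const, Finset.prod_const]
  ring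

lemma subsetExp_const (c : ℝ) : subsetExp δ T (fun _ => c) = c := by
  have := subsetExp_prod (δ := δ) (T := T) (fun _ => 1) (fun _ => 1)
  simp only [Finset.prod_const_one, mul_one, add_sub_cancel] at this
  unfold subsetExp at this ⊢
  rw [← Finset.sum_mul]
  simp only [mul_one] at this
  rw [this, one_mul]

lemma subsetExp_mul_const (f : Finset ℤ → ℝ) (c : ℝ) :
    subsetExp δ T (fun S => f S * c) = subsetExp δ T f * c := by
  unfold subsetExp
  rw [Finset.sum_mul]
  exact Finset.sum_congr rfl fun S _ => by ring

lemma subsetExp_add (f g : Finset ℤ → ℝ) :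
    subsetExp δ T (fun S => f S + g S) = subsetExp δ T f + subsetExp δ T g := by
  unfold subsetExp
  rw [← Finset.sum_add_distrib]
  exact Finset.sum_congr rfl fun S _ => by ring

lemma subsetExp_sum {ι : Type*} (I : Finset ι) (f : ι → Finset ℤ → ℝ) :
    subsetExp δ T (fun S => ∑ i ∈ I, f i S) = ∑ i ∈ I, subsetExp δ T (f i) := by
  unfold subsetExp
  rw [Finset.sum_comm]
  exact Finset.sum_congr rfl fun S _ => by rw [Finset.mul_sum]

/-- First-moment method: if exponential-type costs have small total expectation, some subset has
all its costs smaller than one. -/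
lemma exists_subset_forall_lt_one (h0 : 0 ≤ δ) (h1 : δ ≤ 1) {ι κ : Type*} (I : Finset ι)
    (K : Finset κ) (f : ι → Finset ℤ → ℝ) (g : κ → Finset ℤ → ℝ)
    (hf : ∀ i S, 0 ≤ f i S) (hg : ∀ i S, 0 ≤ g i S)
    (hlt : ∑ i ∈ I, subsetExp δ T (f i) + ∑ i ∈ K, subsetExp δ T (g i) < 1) :
    ∃ S ⊆ T, (∀ i ∈ I, f i S < 1) ∧ ∀ i ∈ K, g i S < 1 := by
  have : ∃ S ⊆ T, ∑ i ∈ I, f i S + ∑ i ∈ K, g i S < 1 := by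
    by_contra! hcon
    rw [← subsetExp_sum, ← subsetExp_sum, ← subsetExp_add] at hlt
    have := subsetExp_mono h0 h1 hcon
    rw [subsetExp_const] at this
    linarith
  obtain ⟨S, hS, h⟩ := this
  have hI := Finset.sum_nonneg (s := I) fun i _ => hf i S
  have hK := Finset.sum_nonneg (s := K) fun i _ => hg i S
  refine ⟨S, hS, fun i hi => ?_, fun i hi => ?_⟩
  · have := Finset.single_le_sum (f := fun i => f i S) (fun i _ => hf i S) hi
    linarith
  · have := Finset.single_le_sum (f := fun i => g i S) (fun i _ => hg i S) hi
    linarith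

lemma subsetExp_rpow_card_inter_le (h0 : 0 ≤ δ) (h1 : δ ≤ 1) {U : Finset ℤ} (hU : U ⊆ T) {z : ℝ}
    (hz : 1 ≤ z) (m : ℝ) :
    subsetExp δ T (fun S => z ^ (((S ∩ U).card : ℝ) - m)) ≤
      Real.exp (δ * z * U.card) * z ^ (-m) := by
  have hz0 : 0 < z := by linarith
  have e : ∀ S, S ⊆ T → z ^ (((S ∩ U).card : ℝ) - m) =
      ((∏ n ∈ S, if n ∈ U then z else 1) * ∏ n ∈ T \ S, (1 : ℝ)) * z ^ (-m) := by
    intro S _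
    rw [sub_eq_add_neg, Real.rpow_add hz0, Real.rpow_natCast, Finset.prod_const_one, mul_one,
      Finset.prod_ite_mem, Finset.prod_const]
  refine (subsetExp_mono h0 h1 fun S hS => (e S hS).le).trans ?_
  rw [subsetExp_mul_const, subsetExp_prod]
  refine mul_le_mul_of_nonneg_right ?_ (by positivity)
  have : ∀ n ∈ T, δ * (if n ∈ U then z else 1) + (1 - δ) * 1 ≤
      if n ∈ U then Real.exp (δ * z) else 1 := by
    intro n _
    split_ifs
    · have := Real.add_one_le_exp (δ * z)
      linarith
    · linarith
  refine (Finset.prod_le_prod (fun n _ => ?_) this).trans ?_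
  · split_ifs <;> nlinarith
  · rw [Finset.prod_ite_mem, Finset.inter_eq_right.2 hU, Finset.prod_const, ← Real.exp_nat_mul]
    apply le_of_eq
    ring_nf

lemma exp_sub_one_sub_le {x : ℝ} (hx : |x| ≤ 1) : Real.exp x ≤ 1 + x + x ^ 2 := by
  have := Real.abs_exp_sub_one_sub_id_le hx
  have := (abs_le.1 this).2
  linarith

lemma subsetExp_exp_le (h0 : 0 ≤ δ) (h1 : δ ≤ 1) {β : ℤ → ℝ} (hβ : ∀ n, |β n| ≤ 1) {s : ℝ}
    (hs0 : 0 ≤ s) (hs1 : s ≤ 1) (t : ℝ) :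
    subsetExp δ T (fun S => Real.exp (s * (∑ n ∈ S, β n - δ * ∑ n ∈ T, β n - t))) ≤
      Real.exp (δ * s ^ 2 * T.card - s * t) := by
  have e : ∀ S, S ⊆ T → Real.exp (s * (∑ n ∈ S, β n - δ * ∑ n ∈ T, β n - t)) =
      ((∏ n ∈ S, Real.exp (s * β n * (1 - δ))) *
        ∏ n ∈ T \ S, Real.exp (-(s * β n * δ))) * Real.exp (- (s * t)) := by
    intro S hS
    rw [← Real.exp_sum, ← Real.exp_sum, ← Real.exp_add, ← Real.exp_add]
    congr 1
    rw [← Finset.sum_sdiff hS]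
    simp only [Finset.sum_neg_distrib, ← Finset.sum_mul, ← Finset.mul_sum]
    ring
  refine (subsetExp_mono h0 h1 fun S hS => (e S hS).le).trans ?_
  rw [subsetExp_mul_const, subsetExp_prod, sub_eq_add_neg _ (s * t), Real.exp_add]
  refine mul_le_mul_of_nonneg_right ?_ (by positivity)
  have hb : ∀ n ∈ T, δ * Real.exp (s * β n * (1 - δ)) + (1 - δ) * Real.exp (-(s * β n * δ)) ≤
      Real.exp (δ * s ^ 2) := by
    intro n _
    have hx : |s * β n| ≤ 1 := by
      rw [abs_mul, abs_of_nonneg hs0]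
      exact mul_le_one₀ hs1 (abs_nonneg _) (hβ n)
    have hx2 : (s * β n) ^ 2 ≤ s ^ 2 := by
      rw [mul_pow]
      have : β n ^ 2 ≤ 1 := (sq_le_one_iff_abs_le_one _).2 (hβ n)
      nlinarith [sq_nonneg s]
    set x := s * β n
    have h2 := exp_sub_one_sub_le hx
    have h3 := Real.add_one_le_exp (δ * (x + x ^ 2))
    calc δ * Real.exp (x * (1 - δ)) + (1 - δ) * Real.exp (-(x * δ))
        = (δ * Real.exp x + (1 - δ)) * Real.exp (-(x * δ)) := by
          rw [show x * (1 - δ) = x + -(x * δ) by ring, Real.exp_add]; ring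
      _ ≤ Real.exp (δ * (x + x ^ 2)) * Real.exp (-(x * δ)) := by
          gcongr
          nlinarith
      _ = Real.exp (δ * x ^ 2) := by rw [← Real.exp_add]; ring_nf
      _ ≤ Real.exp (δ * s ^ 2) := by gcongr
  refine (Finset.prod_le_prod (fun n _ => ?_) hb).trans ?_
  · have : 0 ≤ 1 - δ := by linarith
    positivity
  · rw [Finset.prod_const, ← Real.exp_nat_mul]
    apply le_of_eq
    ring_nf

end RandomSubset

section RandomKernel

lemma norm_fexp_sub_le (n : ℤ) (x y : ℝ) :
    ‖fexp n x - fexp n y‖ ≤ 2 * Real.pi * |(n : ℝ)| * |x - y| := by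
  have h : fexp n x - fexp n y = fexp n y * (fexp n (x - y) - 1) := by
    have : fexp n y * fexp n (x - y) = fexp n x := by
      unfold fexp
      rw [← Complex.exp_add]
      congr 1
      push_cast
      ring
    rw [mul_sub, this, mul_one]
  rw [h, norm_mul, norm_fexp, one_mul]
  have h2 : fexp n (x - y) = Complex.exp (Complex.I * ((2 * Real.pi * n * (x - y) : ℝ) : ℂ)) := by
    unfold fexp
    congr 1
    push_cast
    ring
  rw [h2]
  refine (Real.norm_exp_I_mul_ofReal_sub_one_le).trans ?_
  rw [Real.norm_eq_abs, abs_mul, abs_mul, abs_mul, abs_two, abs_of_pos Real.pi_pos]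

lemma norm_sum_fexp_sub_le {N : ℕ} {S : Finset ℤ} (hS : S ⊆ Finset.Icc 1 (N : ℤ)) (x y : ℝ) :
    ‖∑ n ∈ S, fexp n x - ∑ n ∈ S, fexp n y‖ ≤ N * (2 * Real.pi * N * |x - y|) := by
  rw [← Finset.sum_sub_distrib]
  have hcard : (S.card : ℝ) ≤ N := by
    have := Finset.card_le_card hS
    simp at this
    exact_mod_cast this
  calc ‖∑ n ∈ S, (fexp n x - fexp n y)‖ ≤ ∑ n ∈ S, 2 * Real.pi * N * |x - y| := by
        refine norm_sum_le_of_le _ fun n hn => (norm_fexp_sub_le n x y).trans ?_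
        have h := Finset.mem_Icc.1 (hS hn)
        have : |(n : ℝ)| ≤ N := by
          rw [abs_of_nonneg (by exact_mod_cast (by omega : 0 ≤ n))]
          exact_mod_cast h.2
        have := Real.pi_pos
        gcongr
    _ = S.card * (2 * Real.pi * N * |x - y|) := by rw [Finset.sum_const, nsmul_eq_mul]
    _ ≤ _ := by
        have := Real.pi_pos
        gcongr

/-- The kernel `∑_{n ∈ S} e_n - δ ∑_{n ∈ T} e_n` is controlled by its values on a grid. -/
lemma norm_kernel_le_of_grid {N : ℕ} (hN : 1 ≤ N) {S : Finset ℤ}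
    (hS : S ⊆ Finset.Icc 1 (N : ℤ)) {δ t : ℝ} (h0 : 0 ≤ δ) (h1 : δ ≤ 1) (ht : 26 ≤ t * N)
    (hgrid : ∀ i ∈ Finset.range (N ^ 3), ∀ d ∈ Finset.range 4,
      ∑ n ∈ S, (Complex.I ^ d * fexp n (i / N ^ 3)).re -
        δ * ∑ n ∈ Finset.Icc 1 (N : ℤ), (Complex.I ^ d * fexp n (i / N ^ 3)).re ≤ t) (x : ℝ) :
    ‖∑ n ∈ S, fexp n x - δ * ∑ n ∈ Finset.Icc 1 (N : ℤ), fexp n x‖ ≤ 3 * t := by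
  set T := Finset.Icc 1 (N : ℤ)
  set k : ℝ → ℂ := fun x => ∑ n ∈ S, fexp n x - δ * ∑ n ∈ T, fexp n x with hk
  have hNpos : (0 : ℝ) < N := by exact_mod_cast hN
  have hper : k x = k (Int.fract x) := by
    simp only [hk]
    have : ∀ n, fexp n x = fexp n (Int.fract x) := fun n => by
      conv_lhs => rw [← Int.fract_add_floor x]
      exact fexp_add_intCast n _ _
    simp_rw [this]
  set u := Int.fract x with hu
  have hu0 : 0 ≤ u := Int.fract_nonneg x
  have hu1 : u < 1 := Int.fract_lt_one x
  set i := ⌊u * N ^ 3⌋₊ with hi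
  have hi1 : (i : ℝ) ≤ u * N ^ 3 := Nat.floor_le (by positivity)
  have hi2 : u * N ^ 3 < i + 1 := Nat.lt_floor_add_one _
  have himem : i ∈ Finset.range (N ^ 3) := by
    rw [Finset.mem_range]
    have : (i : ℝ) < (N ^ 3 : ℕ) := by
      push_cast
      have : (0 : ℝ) < (N : ℝ) ^ 3 := by positivity
      nlinarith
    exact_mod_cast this
  have hdist : |u - i / N ^ 3| ≤ 1 / N ^ 3 := by
    have h3 : (0 : ℝ) < (N : ℝ) ^ 3 := by positivity
    have : (i : ℝ) / N ^ 3 ≤ u := (div_le_iff₀ h3).2 hi1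
    rw [abs_of_nonneg (by linarith), sub_le_iff_le_add, ← add_div, le_div_iff₀ h3]
    linarith
  set v : ℝ := i / N ^ 3 with hv
  have hre : ∀ d ∈ Finset.range 4, (Complex.I ^ d * k v).re ≤ t := by
    intro d hd
    refine le_trans (le_of_eq ?_) (hgrid i himem d hd)
    simp only [hk, mul_sub, Complex.sub_re, Finset.mul_sum, Complex.re_sum]
    congr 1
    refine Finset.sum_congr rfl fun n _ => ?_
    rw [mul_left_comm, Complex.re_ofReal_mul]
  have e0 := hre 0 (by simp)
  have e1 := hre 1 (by simp)
  have e2 := hre 2 (by simp)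
  have e3 := hre 3 (by simp)
  have hI3 : Complex.I ^ 3 = -Complex.I := by
    rw [pow_succ, Complex.I_sq]; ring
  rw [hI3] at e3
  simp at e0 e1 e2 e3
  have hkv : ‖k v‖ ≤ 2 * t := by
    refine (Complex.norm_le_abs_re_add_abs_im _).trans ?_
    have h1 : |(k v).re| ≤ t := abs_le.2 ⟨by linarith, e0⟩
    have h2 : |(k v).im| ≤ t := abs_le.2 ⟨by linarith, by linarith⟩
    linarith
  have hlip : ‖k u - k v‖ ≤ t := by
    have : k u - k v = (∑ n ∈ S, fexp n u - ∑ n ∈ S, fexp n v) -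
        δ * (∑ n ∈ T, fexp n u - ∑ n ∈ T, fexp n v) := by
      simp only [hk]; ring
    rw [this]
    have hS' := norm_sum_fexp_sub_le hS u v
    have hT' := norm_sum_fexp_sub_le (subset_refl T) u v
    have hpi := Real.pi_lt_d2
    have hb : (N : ℝ) * (2 * Real.pi * N * |u - v|) ≤ t / 2 := by
      calc (N : ℝ) * (2 * Real.pi * N * |u - v|) ≤ N * (2 * 3.15 * N * (1 / N ^ 3)) := by gcongr
        _ = 6.3 / N := by field_simp; norm_num
        _ ≤ t / 2 := by rw [div_le_iff₀ hNpos]; linarith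
    refine (norm_sub_le _ _).trans ?_
    rw [norm_mul, Complex.norm_real, Real.norm_of_nonneg h0]
    have : δ * ‖∑ n ∈ T, fexp n u - ∑ n ∈ T, fexp n v‖ ≤
        1 * ‖∑ n ∈ T, fexp n u - ∑ n ∈ T, fexp n v‖ := by gcongr
    linarith
  change ‖k x‖ ≤ _
  rw [hper]
  calc ‖k u‖ = ‖(k u - k v) + k v‖ := by rw [sub_add_cancel]
    _ ≤ _ := (norm_add_le _ _).trans (by linarith)

end RandomKernel

/-- The normalising constant of the selection density. -/
def lamConst (p : ℝ) : ℝ := 2 * (4 * p) ^ (2 / p)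

/-- The selection density `c N ^ (2 / p - 1)`. -/
def lamDensity (p : ℝ) (N : ℕ) : ℝ := lamConst p * (N : ℝ) ^ (2 / p - 1)

/-- The small parameter in the intersection bounds for the random set. -/
def lamSmall (p : ℝ) (N : ℕ) : ℝ := (N : ℝ) ^ (-((p - 2) / (8 * p)))

section RandomExistence

open Filter Topology

lemma lamConst_pos {p : ℝ} (hp : 2 < p) : 0 < lamConst p := by
  unfold lamConst
  have : 0 < p := by linarith
  positivity

lemma lamDensity_nonneg {p : ℝ} (hp : 2 < p) (N : ℕ) : 0 ≤ lamDensity p N :=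
  mul_nonneg (lamConst_pos hp).le (by positivity)

lemma tendsto_natCast_rpow_neg {a : ℝ} (ha : a < 0) :
    Tendsto (fun N : ℕ => (N : ℝ) ^ a) atTop (𝓝 0) := by
  have := (tendsto_rpow_neg_atTop (y := -a) (by linarith)).comp tendsto_natCast_atTop_atTop
  simpa [Function.comp_def] using this

lemma tendsto_natCast_rpow_pos {a : ℝ} (ha : 0 < a) :
    Tendsto (fun N : ℕ => (N : ℝ) ^ a) atTop atTop :=
  (tendsto_rpow_atTop ha).comp tendsto_natCast_atTop_atTop

lemma tendsto_lamDensity {p : ℝ} (hp : 2 < p) : Tendsto (lamDensity p) atTop (𝓝 0) := by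
  have h : 2 / p - 1 < 0 := by
    rw [sub_neg, div_lt_one (by linarith)]; exact hp
  unfold lamDensity
  simpa using (tendsto_natCast_rpow_neg h).const_mul (lamConst p)

lemma tendsto_grid_cost {p : ℝ} (hp : 2 < p) (c : ℝ) :
    Tendsto (fun N : ℕ => 4 * (N : ℝ) ^ 3 * Real.exp (c - (N : ℝ) ^ (1 / (4 * p)))) atTop
      (𝓝 0) := by
  have hp0 : 0 < p := by linarith
  have h1 := (tendsto_rpow_mul_exp_neg_mul_atTop_nhds_zero (12 * p) 1 one_pos).comp
    (tendsto_natCast_rpow_pos (a := 1 / (4 * p)) (by positivity))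
  have h2 := h1.const_mul (4 * Real.exp c)
  rw [mul_zero] at h2
  refine h2.congr fun N => ?_
  simp only [Function.comp]
  have e : ((N : ℝ) ^ (1 / (4 * p))) ^ (12 * p) = (N : ℝ) ^ 3 := by
    rw [← Real.rpow_mul (by positivity), ← Real.rpow_natCast]
    congr 1
    field_simp
    norm_num
  rw [e, sub_eq_add_neg, Real.exp_add]
  ring_nf

/-- Existence of a set with a small kernel and small intersections with a prescribed family of
sets indexed by words. -/
lemma exists_random_set {p : ℝ} (hp : 2 < p) (D : ℝ) : ∀ᶠ N : ℕ in atTop,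
    ∀ (V : Type) (Vs : Finset V) (J : ℕ) (U : List V → ℕ → Finset ℤ),
      Vs.card ≤ N ^ 3 → J + 1 ≤ N → (∀ L j, U L j ⊆ Finset.Icc 1 (N : ℤ)) →
      (∀ L j, ((U L j).card : ℝ) ≤ D * 4 ^ j * (N : ℝ) ^ (3 * (p - 2) / (4 * p))) →
      ∃ S ⊆ Finset.Icc 1 (N : ℤ),
        (∀ x, ‖∑ n ∈ S, fexp n x - lamDensity p N * ∑ n ∈ Finset.Icc 1 (N : ℤ), fexp n x‖ ≤
          3 * (N : ℝ) ^ (5 / (4 * p))) ∧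
        ∀ L : List V, L ≠ [] → L.length ≤ N → (∀ v ∈ L, v ∈ Vs) → ∀ j ≤ J,
          ((S ∩ U L j).card : ℝ) ≤ 80 * p / (p - 2) * (L.length + 4 ^ j * lamSmall p N) := by
  have hp0 : 0 < p := by linarith
  filter_upwards [(tendsto_lamDensity hp).eventually_le_const one_pos,
    (tendsto_grid_cost hp (lamConst p)).eventually_lt_const (show (0 : ℝ) < 1 / 2 by norm_num),
    ((Real.tendsto_log_atTop.comp tendsto_natCast_atTop_atTop).eventually_ge_atTop
      (lamConst p * D / 10)), eventually_ge_atTop 26] with N h1 hgrid hlog hN26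
  intro V Vs J U hVs hJ hU hUcard
  simp only [Function.comp] at hlog
  set δ := lamDensity p N with hδ
  have h0 : 0 ≤ δ := lamDensity_nonneg hp N
  have hNR : (26 : ℝ) ≤ N := by exact_mod_cast hN26
  have hN0 : (0 : ℝ) < N := by linarith
  set T := Finset.Icc 1 (N : ℤ) with hT
  have hTcard : (T.card : ℝ) = N := by simp [hT]
  set y := lamSmall p N with hy
  have hy0 : 0 < y := Real.rpow_pos_of_pos hN0 _
  set t := (N : ℝ) ^ (5 / (4 * p)) with ht
  set s := (N : ℝ) ^ (-(1 / p)) with hs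
  have hs0 : 0 < s := Real.rpow_pos_of_pos hN0 _
  have hs1 : s ≤ 1 := Real.rpow_le_one_of_one_le_of_nonpos (by linarith)
    (by rw [neg_nonpos]; positivity)
  set C1 := 80 * p / (p - 2) with hC1
  let f : ℕ × ℕ → Finset ℤ → ℝ := fun i S => Real.exp (s *
    (∑ n ∈ S, (Complex.I ^ i.2 * fexp n (i.1 / N ^ 3)).re -
      δ * ∑ n ∈ T, (Complex.I ^ i.2 * fexp n (i.1 / N ^ 3)).re - t))
  let g : (Σ E : ℕ, (Fin E → V) × ℕ) → Finset ℤ → ℝ := fun i S =>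
    (y⁻¹) ^ (((S ∩ U (List.ofFn i.2.1) i.2.2).card : ℝ) - C1 * (i.1 + 4 ^ i.2.2 * y))
  let K : Finset (Σ E : ℕ, (Fin E → V) × ℕ) := (Finset.Icc 1 N).sigma fun E =>
    (Fintype.piFinset fun _ => Vs) ×ˢ Finset.range (J + 1)
  have hf : ∀ i, subsetExp δ T (f i) ≤ Real.exp (lamConst p - (N : ℝ) ^ (1 / (4 * p))) := by
    intro i
    refine (subsetExp_exp_le h0 h1 (β := fun n => (Complex.I ^ i.2 * fexp n (i.1 / N ^ 3)).re)
      (fun n => ?_) hs0.le hs1 t).trans ?_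
    · refine (Complex.abs_re_le_norm _).trans ?_
      rw [norm_mul, norm_pow, Complex.norm_I, one_pow, norm_fexp, mul_one]
    · rw [hTcard]
      apply le_of_eq
      congr 1
      congr 1
      · rw [hδ, lamDensity, hs, ← Real.rpow_natCast, ← Real.rpow_mul hN0.le, mul_assoc, mul_assoc]
        conv_lhs => rw [show (N : ℝ) ^ (2 / p - 1) * ((N : ℝ) ^ (-(1 / p) * ((2 : ℕ) : ℝ)) * N) =
          (N : ℝ) ^ (2 / p - 1) * ((N : ℝ) ^ (-(1 / p) * ((2 : ℕ) : ℝ)) * (N : ℝ) ^ (1 : ℝ)) by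
            rw [Real.rpow_one]]
        rw [← Real.rpow_add hN0, ← Real.rpow_add hN0]
        rw [show 2 / p - 1 + (-(1 / p) * ((2 : ℕ) : ℝ) + 1) = 0 by push_cast; ring, Real.rpow_zero,
          mul_one]
      · rw [hs, ht, ← Real.rpow_add hN0]
        congr 1
        field_simp
        norm_num
  have hylog : Real.log y⁻¹ = (p - 2) / (8 * p) * Real.log N := by
    rw [Real.log_inv, hy, lamSmall, Real.log_rpow hN0]
    ring
  have hz1 : 1 ≤ y⁻¹ := by
    rw [one_le_inv₀ hy0]
    refine Real.rpow_le_one_of_one_le_of_nonpos (by linarith) ?_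
    rw [neg_nonpos]
    exact div_nonneg (by linarith) (by positivity)
  have hg : ∀ i, subsetExp δ T (g i) ≤ ((N : ℝ) ^ (10 * i.1))⁻¹ := by
    intro i
    refine (subsetExp_rpow_card_inter_le h0 h1 (hU (List.ofFn i.2.1) i.2.2) hz1 _).trans ?_
    rw [Real.rpow_def_of_pos (by positivity), ← Real.exp_add,
      ← Real.rpow_natCast (N : ℝ) (10 * i.1), ← Real.rpow_neg hN0.le, Real.rpow_def_of_pos hN0,
      Real.exp_le_exp, hylog]
    set j := i.2.2
    set E : ℝ := (i.1 : ℝ)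
    have hfirst : δ * y⁻¹ * ((U (List.ofFn i.2.1) j).card : ℝ) ≤
        lamConst p * D * (4 ^ j * y) := by
      calc δ * y⁻¹ * ((U (List.ofFn i.2.1) j).card : ℝ)
          ≤ δ * y⁻¹ * (D * 4 ^ j * (N : ℝ) ^ (3 * (p - 2) / (4 * p))) := by
            gcongr
            exact hUcard _ _
        _ = lamConst p * D * 4 ^ j * ((N : ℝ) ^ (2 / p - 1) * (y⁻¹ *
              (N : ℝ) ^ (3 * (p - 2) / (4 * p)))) := by
            rw [hδ, lamDensity]; ring
        _ = _ := by
            rw [hy, lamSmall, ← Real.rpow_neg hN0.le, ← Real.rpow_add hN0, ← Real.rpow_add hN0,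
              mul_assoc]
            congr 3
            field_simp
            ring
    have hsecond : (p - 2) / (8 * p) * Real.log N * -(C1 * (E + 4 ^ j * y)) =
        -(10 * Real.log N * (E + 4 ^ j * y)) := by
      have : p - 2 ≠ 0 := by linarith
      rw [hC1]
      field_simp
      ring
    rw [hsecond]
    push_cast
    have h4 : 0 < (4 : ℝ) ^ j * y := by positivity
    nlinarith
  obtain ⟨S, hST, hS1, hS2⟩ := exists_subset_forall_lt_one h0 h1 (T := T)
    (Finset.range (N ^ 3) ×ˢ Finset.range 4) K f g (fun _ _ => (Real.exp_pos _).le)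
    (fun _ _ => Real.rpow_nonneg (by positivity) _) (by
      have e1 : ∑ i ∈ Finset.range (N ^ 3) ×ˢ Finset.range 4, subsetExp δ T (f i) < 1 / 2 := by
        refine lt_of_le_of_lt (Finset.sum_le_sum fun i _ => hf i) ?_
        rw [Finset.sum_const, Finset.card_product, Finset.card_range, Finset.card_range,
          nsmul_eq_mul]
        push_cast
        rw [mul_comm ((N : ℝ) ^ 3)]
        exact hgrid
      have e2 : ∑ i ∈ K, subsetExp δ T (g i) ≤ 1 / 2 := by
        refine (Finset.sum_le_sum fun i _ => hg i).trans ?_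
        rw [Finset.sum_sigma]
        have : ∀ E ∈ Finset.Icc 1 N, ∑ i ∈ (Fintype.piFinset fun _ : Fin E => Vs) ×ˢ
            Finset.range (J + 1), ((N : ℝ) ^ (10 * E))⁻¹ ≤ 1 / (2 * N) := by
          intro E hE
          have hE1 := (Finset.mem_Icc.1 hE).1
          rw [Finset.sum_const, nsmul_eq_mul, Finset.card_product, Fintype.card_piFinset_const,
            Finset.card_range]
          have hNE : (N : ℝ) ≤ (N : ℝ) ^ E := le_self_pow₀ (by linarith) (by omega)
          have hV : ((Vs.card : ℝ)) ^ E ≤ ((N : ℝ) ^ 3) ^ E := by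
            gcongr
            exact_mod_cast hVs
          have hJ' : ((J + 1 : ℕ) : ℝ) ≤ N ^ E := le_trans (by exact_mod_cast hJ) hNE
          rw [← div_eq_mul_inv, div_le_div_iff₀ (by positivity) (by positivity), one_mul]
          push_cast at hJ' ⊢
          calc (Vs.card : ℝ) ^ E * (J + 1) * (2 * N)
              ≤ ((N : ℝ) ^ 3) ^ E * N ^ E * (N ^ E * N ^ E) := by
                have : (2 : ℝ) ≤ N ^ E := by linarith
                gcongr
            _ = (N : ℝ) ^ (6 * E) := by ring
            _ ≤ (N : ℝ) ^ (10 * E) := pow_le_pow_right₀ (by linarith) (by omega)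
        refine (Finset.sum_le_sum this).trans ?_
        rw [Finset.sum_const, Nat.card_Icc, nsmul_eq_mul, Nat.add_sub_cancel]
        apply le_of_eq
        field_simp
      linarith)
  refine ⟨S, hST, ?_, ?_⟩
  · refine norm_kernel_le_of_grid (by omega) hST h0 h1 ?_ ?_
    · have : 1 ≤ t := Real.one_le_rpow (by linarith) (by positivity)
      nlinarith
    · intro i hi d hd
      have := hS1 (i, d) (Finset.mem_product.2 ⟨hi, hd⟩)
      simp only [f] at this
      rw [Real.exp_lt_one_iff] at this
      have := neg_of_mul_neg_right this hs0.le
      linarith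
  · intro L hL hLN hLV j hj
    have hmem : (⟨L.length, L.get, j⟩ : Σ E : ℕ, (Fin E → V) × ℕ) ∈ K := by
      simp only [K, Finset.mem_sigma, Finset.mem_Icc, Finset.mem_product, Fintype.mem_piFinset,
        Finset.mem_range]
      refine ⟨⟨List.length_pos_iff.2 hL, hLN⟩, fun i => hLV _ (List.get_mem _ _), by omega⟩
    have := hS2 _ hmem
    simp only [g, List.ofFn_get] at this
    by_contra! hcon
    have h2 := Real.one_le_rpow hz1 (sub_nonneg.2 hcon.le)
    linarith

end RandomExistence

section Selection

open scoped Classical in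
/-- The letters of `A` at level `j` that may be prepended to the word `L`. -/
def goodLetters (A : Finset ℤ) (lev : ℤ → ℕ) (good : ℤ → List ℤ → Prop) (j : ℕ) (L : List ℤ) :
    Finset ℤ := A.filter fun n => lev n = j ∧ good n L

/-- One step of a Markov process on words: each good letter of level `j` is prepended with
probability `q`. -/
def wordStep (A : Finset ℤ) (lev : ℤ → ℕ) (good : ℤ → List ℤ → Prop) (q : ℝ) (j : ℕ)
    (X : List ℤ → ℝ) (L : List ℤ) : ℝ :=
  X L + q * ∑ n ∈ goodLetters A lev good j L, (X (n :: L) - X L)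

/-- The expectation of `X` after `t` steps of the word process started at the empty word, the
levels running through consecutive blocks of length `P`. -/
def wordExp (A : Finset ℤ) (lev : ℤ → ℕ) (good : ℤ → List ℤ → Prop) (q : ℝ) (P : ℕ) :
    ℕ → (List ℤ → ℝ) → ℝ
  | 0, X => X []
  | t + 1, X => wordExp A lev good q P t (wordStep A lev good q (t / P) X)

variable {A : Finset ℤ} {lev : ℤ → ℕ} {good : ℤ → List ℤ → Prop} {q : ℝ} {P : ℕ}

lemma mem_goodLetters {j : ℕ} {L : List ℤ} {n : ℤ} :
    n ∈ goodLetters A lev good j L ↔ n ∈ A ∧ lev n = j ∧ good n L := by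
  unfold goodLetters
  simp

lemma goodLetters_subset {j : ℕ} {L : List ℤ} : goodLetters A lev good j L ⊆ A :=
  fun _ hn => (mem_goodLetters.1 hn).1

lemma wordExp_mono (hq : 0 ≤ q) (hqA : q * A.card ≤ 1) (t : ℕ) {X Y : List ℤ → ℝ}
    (h : ∀ L : List ℤ, (∀ n ∈ L, n ∈ A) → X L ≤ Y L) :
    wordExp A lev good q P t X ≤ wordExp A lev good q P t Y := by
  induction t generalizing X Y with
  | zero => exact h [] (by simp)
  | succ t ih =>
    refine ih fun L hL => ?_
    unfold wordStep
    set G := goodLetters A lev good (t / P) L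
    have hG : q * G.card ≤ 1 := by
      refine le_trans ?_ hqA
      have : (G.card : ℝ) ≤ A.card := by
        exact_mod_cast Finset.card_le_card goodLetters_subset
      gcongr
    have h1 : ∑ n ∈ G, X (n :: L) ≤ ∑ n ∈ G, Y (n :: L) := by
      refine Finset.sum_le_sum fun n hn => h _ ?_
      intro m hm
      rcases List.mem_cons.1 hm with rfl | hm
      · exact goodLetters_subset hn
      · exact hL m hm
    have h2 := h L hL
    simp only [Finset.sum_sub_distrib, Finset.sum_const, nsmul_eq_mul]
    nlinarith [mul_le_mul_of_nonneg_left h1 hq, mul_nonneg (sub_nonneg.2 h2) (sub_nonneg.2 hG)]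

lemma wordExp_add_mul (t : ℕ) (X Y : List ℤ → ℝ) (c : ℝ) :
    wordExp A lev good q P t (fun L => X L + c * Y L) =
      wordExp A lev good q P t X + c * wordExp A lev good q P t Y := by
  induction t generalizing X Y with
  | zero => rfl
  | succ t ih =>
    simp only [wordExp]
    rw [← ih]
    congr 1
    ext L
    simp only [wordStep, Finset.sum_sub_distrib, Finset.sum_add_distrib, ← Finset.mul_sum,
      Finset.sum_const, nsmul_eq_mul]
    ring

lemma wordExp_const (t : ℕ) (c : ℝ) : wordExp A lev good q P t (fun _ => c) = c := by
  induction t with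
  | zero => rfl
  | succ t ih =>
    simp only [wordExp]
    conv_rhs => rw [← ih]
    congr 1
    ext L
    simp [wordStep]

lemma wordExp_const_mul (t : ℕ) (X : List ℤ → ℝ) (c : ℝ) :
    wordExp A lev good q P t (fun L => c * X L) = c * wordExp A lev good q P t X := by
  have := wordExp_add_mul (A := A) (lev := lev) (good := good) (q := q) (P := P) t
    (fun _ => 0) X c
  rw [wordExp_const] at this
  simpa using this

lemma wordExp_sum (t : ℕ) {ι : Type*} (I : Finset ι) (X : ι → List ℤ → ℝ) (c : ι → ℝ) (d : ℝ) :
    wordExp A lev good q P t (fun L => d + ∑ i ∈ I, c i * X i L) =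
      d + ∑ i ∈ I, c i * wordExp A lev good q P t (X i) := by
  classical
  induction I using Finset.induction_on with
  | empty => simpa using wordExp_const t d
  | insert i I hi ih =>
    simp only [Finset.sum_insert hi]
    rw [add_comm (c i * _), ← add_assoc, ← ih, ← wordExp_add_mul]
    congr 1
    ext L
    ring

lemma sum_range_mul_div (f : ℕ → ℝ) (P : ℕ) (hP : 0 < P) (n : ℕ) :
    ∑ t ∈ Finset.range (n * P), f (t / P) = P * ∑ j ∈ Finset.range n, f j := by
  induction n with
  | zero => simp
  | succ n ih =>
    rw [Nat.succ_mul, Finset.sum_range_add, ih, Finset.sum_range_succ, mul_add]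
    congr 1
    rw [Finset.sum_congr rfl (g := fun _ => f n)]
    · simp
    · intro i hi
      rw [mul_comm n P, Nat.mul_add_div hP, Nat.div_eq_of_lt (Finset.mem_range.1 hi), add_zero]

lemma sum_quarter_pow_mul_sum (a : ℕ → ℝ) (n : ℕ) :
    ∑ j ∈ Finset.range n, (1 / 4 : ℝ) ^ j * ∑ i ∈ Finset.range (j + 1), a i =
      4 / 3 * ∑ i ∈ Finset.range n, a i * ((1 / 4) ^ i - (1 / 4) ^ n) := by
  induction n with
  | zero => simp
  | succ n ih =>
    rw [Finset.sum_range_succ, ih]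
    simp only [mul_sub, Finset.sum_sub_distrib, ← Finset.sum_mul]
    rw [Finset.sum_range_succ (fun i => a i * (1 / 4 : ℝ) ^ i), Finset.sum_range_succ a n]
    ring

/-- The deterministic output of the random selection: weights `γ` retaining most of the mass
`∑ 4 ^ (-lev n)`, for which a Jensen-type inequality holds. -/
lemma exists_selection (J : ℕ) (hlev : ∀ n ∈ A, lev n ≤ J)
    (hw : ∑ n ∈ A, (1 / 4 : ℝ) ^ lev n ≤ 1) (Φ : List ℤ → ℝ) (hΦ : ∀ L, 0 ≤ Φ L) {K : ℝ}
    (hK : 0 ≤ K)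
    (hgood : ∀ L : List ℤ, ∀ n ∈ A, good n L → Φ (n :: L) ≤ Φ L * (1 + K * (1 / 4) ^ lev n))
    {C y ε : ℝ} (hC : 0 ≤ C) (hε : 0 < ε) (hε1 : ε ≤ 1)
    (hbad : ∀ L : List ℤ, (∀ n ∈ L, n ∈ A) → ∀ j ≤ J, ∀ B ⊆ A,
      (∀ n ∈ B, lev n = j ∧ ¬ good n L) → (B.card : ℝ) ≤ C * (L.length + 4 ^ j * y)) :
    ∃ γ : ℤ → ℝ, (∀ n ∈ A, 0 ≤ γ n ∧ γ n ≤ 1) ∧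
      ∑ n ∈ A, (1 / 4 : ℝ) ^ lev n * (1 - γ n) ≤ C * (4 / 3 * ε + (J + 1) * y) ∧
      ∀ (c : ℝ) (h : ℤ → ℝ), (∀ L : List ℤ, (∀ n ∈ L, n ∈ A) → c + (L.map h).sum ≤ Φ L) →
        c + ε * ∑ n ∈ A, γ n * h n ≤ Real.exp (K * ε) * Φ [] := by
  classical
  set P := A.card + 1 with hP
  have hP0 : 0 < P := Nat.succ_pos _
  have hPR : (0 : ℝ) < P := by exact_mod_cast hP0
  set q := ε / P with hq
  have hq0 : 0 < q := by positivity
  have hqP : q * P = ε := div_mul_cancel₀ _ hPR.ne'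
  have hqA : q * A.card ≤ 1 := by
    have : (P : ℝ) = A.card + 1 := by rw [hP]; push_cast; ring
    nlinarith
  set Λ := wordExp A lev good q P with hΛ
  set lvl : ℕ → Finset ℤ := fun j => A.filter fun n => lev n = j with hlvl
  have hlvl_sum : ∀ f : ℤ → ℝ, ∑ j ∈ Finset.range (J + 1), ∑ n ∈ lvl j, f n = ∑ n ∈ A, f n := by
    intro f
    exact Finset.sum_fiberwise_of_maps_to
      (fun n hn => Finset.mem_range.2 (Nat.lt_succ_of_le (hlev n hn))) f
  have hGsub : ∀ j L, goodLetters A lev good j L ⊆ lvl j := by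
    intro j L n hn
    obtain ⟨h1, h2, _⟩ := mem_goodLetters.1 hn
    exact Finset.mem_filter.2 ⟨h1, h2⟩
  set τ := (J + 1) * P with hτ
  set w : ℤ → ℝ := fun n => (1 / 4 : ℝ) ^ lev n with hw'
  have hwpos : ∀ n, 0 < w n := fun n => by simp only [hw']; positivity
  set W : ℕ → ℝ := fun j => ∑ n ∈ lvl j, w n with hW
  have hW0 : ∀ j, 0 ≤ W j := fun j => Finset.sum_nonneg fun n _ => (hwpos n).le
  have hWsum : ∑ j ∈ Finset.range (J + 1), W j = ∑ n ∈ A, w n := hlvl_sum w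
  have hWcard : ∀ j, W j = (lvl j).card * (1 / 4 : ℝ) ^ j := by
    intro j
    simp only [hW, hw']
    rw [Finset.sum_congr rfl (g := fun _ => (1 / 4 : ℝ) ^ j), Finset.sum_const, nsmul_eq_mul]
    intro n hn
    rw [(Finset.mem_filter.1 hn).2]
  -- growth of `Φ`
  have hgrow : ∀ t, Λ t Φ ≤ Real.exp (K * q * ∑ s ∈ Finset.range t, W (s / P)) * Φ [] := by
    intro t
    induction t with
    | zero => simp [hΛ, wordExp]
    | succ t ih =>
      have h1 : Λ (t + 1) Φ ≤ Λ t (fun L => (1 + K * q * W (t / P)) * Φ L) := by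
        refine wordExp_mono hq0.le hqA t fun L _ => ?_
        have : ∑ n ∈ goodLetters A lev good (t / P) L, (Φ (n :: L) - Φ L) ≤
            ∑ n ∈ lvl (t / P), K * w n * Φ L := by
          refine (Finset.sum_le_sum fun n hn => ?_).trans
            (Finset.sum_le_sum_of_subset_of_nonneg (hGsub _ _) fun n _ _ =>
              mul_nonneg (mul_nonneg hK (hwpos n).le) (hΦ L))
          obtain ⟨h1, _, h3⟩ := mem_goodLetters.1 hn
          have := hgood L n h1 h3
          simp only [hw']
          linarith
        rw [← Finset.sum_mul, ← Finset.mul_sum] at this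
        unfold wordStep
        have := mul_le_mul_of_nonneg_left this hq0.le
        linarith
      rw [show (Λ t fun L => (1 + K * q * W (t / P)) * Φ L) = (1 + K * q * W (t / P)) * Λ t Φ from
        wordExp_const_mul t Φ _] at h1
      have h2 := Real.add_one_le_exp (K * q * W (t / P))
      have h3 : 0 ≤ K * q * W (t / P) := mul_nonneg (mul_nonneg hK hq0.le) (hW0 _)
      rw [Finset.sum_range_succ, mul_add, Real.exp_add]
      calc Λ (t + 1) Φ ≤ (1 + K * q * W (t / P)) * Λ t Φ := h1
        _ ≤ (1 + K * q * W (t / P)) *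
            (Real.exp (K * q * ∑ s ∈ Finset.range t, W (s / P)) * Φ []) := by gcongr
        _ ≤ Real.exp (K * q * W (t / P)) *
            (Real.exp (K * q * ∑ s ∈ Finset.range t, W (s / P)) * Φ []) := by
            have := hΦ []
            gcongr
            linarith
        _ = _ := by ring
  have hgrowτ : Λ τ Φ ≤ Real.exp (K * ε) * Φ [] := by
    refine (hgrow τ).trans ?_
    rw [hτ, sum_range_mul_div _ _ hP0, hWsum]
    refine mul_le_mul_of_nonneg_right (Real.exp_le_exp.2 ?_) (hΦ [])
    calc K * q * (P * ∑ n ∈ A, w n) = K * (q * P) * ∑ n ∈ A, w n := by ring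
      _ ≤ K * (q * P) * 1 := by gcongr
      _ = K * ε := by rw [hqP, mul_one]
  -- expected length
  have hlen : ∀ t, Λ t (fun L => (L.length : ℝ)) ≤
      q * ∑ s ∈ Finset.range t, ((lvl (s / P)).card : ℝ) := by
    intro t
    induction t with
    | zero => simp [hΛ, wordExp]
    | succ t ih =>
      have h1 : Λ (t + 1) (fun L => (L.length : ℝ)) ≤
          Λ t (fun L => (q * (lvl (t / P)).card) + 1 * (L.length : ℝ)) := by
        refine wordExp_mono hq0.le hqA t fun L _ => ?_
        simp only [wordStep, List.length_cons, Nat.cast_add, Nat.cast_one, add_sub_cancel_left,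
          Finset.sum_const, nsmul_eq_mul, mul_one]
        have : ((goodLetters A lev good (t / P) L).card : ℝ) ≤ (lvl (t / P)).card := by
          exact_mod_cast Finset.card_le_card (hGsub _ _)
        have := mul_le_mul_of_nonneg_left this hq0.le
        linarith
      rw [hΛ, wordExp_add_mul, wordExp_const, ← hΛ] at h1
      rw [Finset.sum_range_succ]
      linarith
  have hlen' : ∀ t, Λ t (fun L => (L.length : ℝ)) ≤
      ε * ∑ i ∈ Finset.range (t / P + 1), ((lvl i).card : ℝ) := by
    intro t
    refine (hlen t).trans ?_
    rw [← hqP, mul_assoc, ← sum_range_mul_div _ _ hP0]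
    have : t < (t / P + 1) * P := by
      rw [mul_comm]; exact Nat.lt_mul_div_succ t hP0
    gcongr
  -- expected mass
  have hmass : ∀ t, t ≤ τ → q * ∑ s ∈ Finset.range t, (W (s / P) - C * y -
      C * ε * ((1 / 4 : ℝ) ^ (s / P) * ∑ i ∈ Finset.range (s / P + 1), ((lvl i).card : ℝ))) ≤
      Λ t (fun L => (L.map w).sum) := by
    intro t
    induction t with
    | zero => simp [hΛ, wordExp]
    | succ t ih =>
      intro ht
      have hj : t / P ≤ J := by
        have : t / P < J + 1 := by
          rw [Nat.div_lt_iff_lt_mul hP0]; omega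
        omega
      have h1 : Λ t (fun L => ((L.map w).sum + q * (W (t / P) - C * y)) +
          (-(q * C * (1 / 4) ^ (t / P))) * (L.length : ℝ)) ≤
          Λ (t + 1) (fun L => (L.map w).sum) := by
        refine wordExp_mono hq0.le hqA t fun L hL => ?_
        simp only [wordStep, List.map_cons, List.sum_cons, add_sub_cancel_right]
        have hb := hbad L hL (t / P) hj (lvl (t / P) \ goodLetters A lev good (t / P) L)
          (fun n hn => (Finset.mem_filter.1 (Finset.mem_sdiff.1 hn).1).1) (fun n hn => by
            obtain ⟨h1, h2⟩ := Finset.mem_sdiff.1 hn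
            obtain ⟨h3, h4⟩ := Finset.mem_filter.1 h1
            exact ⟨h4, fun hg => h2 (mem_goodLetters.2 ⟨h3, h4, hg⟩)⟩)
        have hsplit := Finset.sum_sdiff (f := w) (hGsub (t / P) L)
        have hbs : ∑ n ∈ lvl (t / P) \ goodLetters A lev good (t / P) L, w n =
            (lvl (t / P) \ goodLetters A lev good (t / P) L).card * (1 / 4 : ℝ) ^ (t / P) := by
          rw [Finset.sum_congr rfl (g := fun _ => (1 / 4 : ℝ) ^ (t / P)), Finset.sum_const,
            nsmul_eq_mul]
          intro n hn
          simp only [hw']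
          rw [(Finset.mem_filter.1 (Finset.mem_sdiff.1 hn).1).2]
        have h4 : (4 : ℝ) ^ (t / P) * (1 / 4) ^ (t / P) = 1 := by
          rw [← mul_pow]; norm_num
        have h5 : (0 : ℝ) < (1 / 4) ^ (t / P) := by positivity
        have h6 := mul_le_mul_of_nonneg_right hb h5.le
        rw [← hbs] at h6
        have h7 : ∑ n ∈ goodLetters A lev good (t / P) L, w n ≥
            W (t / P) - C * ((1 / 4) ^ (t / P) * L.length + y) := by
          have : C * (L.length + 4 ^ (t / P) * y) * (1 / 4) ^ (t / P) =
              C * ((1 / 4) ^ (t / P) * L.length + y * (4 ^ (t / P) * (1 / 4) ^ (t / P))) := by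
            ring
          rw [h4, mul_one] at this
          simp only [hW]
          linarith
        have := mul_le_mul_of_nonneg_left h7 hq0.le
        linarith
      rw [hΛ, wordExp_add_mul, ← hΛ] at h1
      have h2 : Λ t (fun L => (L.map w).sum + q * (W (t / P) - C * y)) =
          Λ t (fun L => (L.map w).sum) + q * (W (t / P) - C * y) := by
        have := wordExp_add_mul (A := A) (lev := lev) (good := good) (q := q) (P := P) t
          (fun L => (L.map w).sum) (fun _ => q * (W (t / P) - C * y)) 1
        rw [wordExp_const] at this
        simpa using this
      rw [h2] at h1
      have h3 := mul_le_mul_of_nonneg_left (hlen' t)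
        (show 0 ≤ q * C * (1 / 4) ^ (t / P) by positivity)
      rw [Finset.sum_range_succ, mul_add]
      have := ih (by omega)
      linarith
  -- the selection weights
  set cnt : ℤ → List ℤ → ℝ := fun n L => (L.count n : ℝ) with hcnt
  have hcnt_sum : ∀ (h : ℤ → ℝ) (L : List ℤ), (∀ n ∈ L, n ∈ A) →
      (L.map h).sum = ∑ n ∈ A, h n * cnt n L := by
    intro h L
    induction L with
    | nil => intro _; simp [hcnt]
    | cons m L ih =>
      intro hL
      rw [List.map_cons, List.sum_cons, ih fun n hn => hL n (List.mem_cons_of_mem _ hn)]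
      simp only [hcnt, List.count_cons, Nat.cast_add, mul_add, Finset.sum_add_distrib]
      rw [add_comm]
      congr 1
      simp [hL m List.mem_cons_self]
  have hcnt0 : ∀ n, 0 ≤ Λ τ (cnt n) := by
    intro n
    have := wordExp_mono (lev := lev) (good := good) (P := P) hq0.le hqA τ (X := fun _ => 0)
      (Y := cnt n) fun L _ => by simp [hcnt]
    rwa [wordExp_const] at this
  have hcnt1 : ∀ n ∈ A, Λ τ (cnt n) ≤ ε := by
    intro n hn
    have h1 : ∀ t, Λ t (cnt n) ≤ q * ∑ s ∈ Finset.range t, if s / P = lev n then 1 else 0 := by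
      intro t
      induction t with
      | zero => simp [hΛ, wordExp, hcnt]
      | succ t ih =>
        have h1 : Λ (t + 1) (cnt n) ≤
            Λ t (fun L => q * (if t / P = lev n then 1 else 0) + 1 * cnt n L) := by
          refine wordExp_mono hq0.le hqA t fun L _ => ?_
          unfold wordStep
          have : ∑ m ∈ goodLetters A lev good (t / P) L, (cnt n (m :: L) - cnt n L) ≤
              if t / P = lev n then 1 else 0 := by
            have e : ∀ m, cnt n (m :: L) - cnt n L = if m = n then 1 else 0 := by
              intro m
              simp only [hcnt, List.count_cons, beq_iff_eq]
              push_cast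
              rw [add_sub_cancel_left]
            simp only [e, Finset.sum_ite_eq']
            split_ifs with h1 h2 h2
            · exact le_rfl
            · exact absurd (mem_goodLetters.1 h1).2.1.symm h2
            · exact zero_le_one
            · exact le_rfl
          have := mul_le_mul_of_nonneg_left this hq0.le
          linarith
        rw [hΛ, wordExp_add_mul, wordExp_const, ← hΛ] at h1
        rw [Finset.sum_range_succ]
        linarith
    refine (h1 τ).trans ?_
    rw [hτ, sum_range_mul_div (fun j => if j = lev n then (1 : ℝ) else 0) _ hP0, ← mul_assoc, hqP]
    rw [Finset.sum_ite_eq', if_pos (Finset.mem_range.2 (Nat.lt_succ_of_le (hlev n hn))), mul_one]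
  refine ⟨fun n => Λ τ (cnt n) / ε, fun n hn => ⟨div_nonneg (hcnt0 n) hε.le,
    (div_le_one hε).2 (hcnt1 n hn)⟩, ?_, ?_⟩
  · have h1 := hmass τ le_rfl
    have h2 : Λ τ (fun L => (L.map w).sum) = ∑ n ∈ A, w n * Λ τ (cnt n) := by
      have e := wordExp_sum (A := A) (lev := lev) (good := good) (q := q) (P := P) τ A cnt w 0
      simp only [zero_add] at e
      rw [← hΛ] at e
      rw [← e]
      refine le_antisymm (wordExp_mono hq0.le hqA τ fun L hL => (hcnt_sum w L hL).le)
        (wordExp_mono hq0.le hqA τ fun L hL => (hcnt_sum w L hL).ge)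
    rw [h2] at h1
    have h3 := sum_range_mul_div (fun j => W j - C * y -
      C * ε * ((1 / 4 : ℝ) ^ j * ∑ i ∈ Finset.range (j + 1), ((lvl i).card : ℝ))) P hP0 (J + 1)
    rw [← hτ] at h3
    have hquarter : ∑ j ∈ Finset.range (J + 1), C * ε * ((1 / 4 : ℝ) ^ j *
        ∑ i ∈ Finset.range (j + 1), ((lvl i).card : ℝ)) = C * ε * (4 / 3 *
          ∑ i ∈ Finset.range (J + 1), ((lvl i).card : ℝ) * ((1 / 4) ^ i - (1 / 4) ^ (J + 1))) := by
      rw [← Finset.mul_sum, sum_quarter_pow_mul_sum]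
    rw [h3, ← mul_assoc, hqP, Finset.sum_sub_distrib, Finset.sum_sub_distrib, hWsum,
      hquarter, Finset.sum_const, Finset.card_range, nsmul_eq_mul] at h1
    have h4 : ∑ i ∈ Finset.range (J + 1),
        ((lvl i).card : ℝ) * ((1 / 4) ^ i - (1 / 4) ^ (J + 1)) ≤ 1 := by
      refine le_trans ?_ hw
      rw [← hWsum]
      refine Finset.sum_le_sum fun i _ => ?_
      rw [hWcard]
      gcongr
      linarith [show (0 : ℝ) < (1 / 4) ^ (J + 1) by positivity]
    have h5 : ∑ n ∈ A, (1 / 4 : ℝ) ^ lev n * (1 - Λ τ (cnt n) / ε) =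
        ∑ n ∈ A, w n - (∑ n ∈ A, w n * Λ τ (cnt n)) / ε := by
      rw [Finset.sum_div, ← Finset.sum_sub_distrib]
      refine Finset.sum_congr rfl fun n _ => ?_
      simp only [hw']
      ring
    rw [h5, sub_le_iff_le_add, ← sub_le_iff_le_add', le_div_iff₀ hε]
    push_cast at h1
    have h6 := mul_le_mul_of_nonneg_left h4 (show 0 ≤ ε * (C * ε * (4 / 3)) by positivity)
    linarith
  · intro c h hh
    have h1 : c + ∑ n ∈ A, h n * Λ τ (cnt n) ≤ Λ τ Φ := by
      have e := wordExp_sum (A := A) (lev := lev) (good := good) (q := q) (P := P) τ A cnt h c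
      rw [← hΛ] at e
      rw [← e]
      refine wordExp_mono hq0.le hqA τ fun L hL => ?_
      rw [← hcnt_sum h L hL]
      exact hh L hL
    have h2 : ε * ∑ n ∈ A, Λ τ (cnt n) / ε * h n = ∑ n ∈ A, h n * Λ τ (cnt n) := by
      rw [Finset.mul_sum]
      refine Finset.sum_congr rfl fun n _ => ?_
      field_simp
    rw [h2]
    exact h1.trans hgrowτ

end Selection

/-- The trigonometric polynomial spelled by a word of (frequency, coefficient) pairs. -/
def wordSum (L : List (ℤ × ℂ)) (x : ℝ) : ℂ := (L.map fun v => v.2 * fexp v.1 x).sum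

/-- The gradient of the energy density at `wordSum L`. -/
def wordGrad (α Q : ℝ) (L : List (ℤ × ℂ)) (x : ℝ) : ℂ :=
  (truncWeight α Q (‖wordSum L x‖ ^ 2) : ℂ) * wordSum L x

/-- The truncated `L^p` energy of `wordSum L`. -/
def wordEnergy (α Q : ℝ) (L : List (ℤ × ℂ)) : ℝ :=
  ∫ x, truncPow α Q (‖wordSum L x‖ ^ 2) ∂unitMeasure

open scoped Classical in
/-- The frequencies at which the gradient has a large Fourier coefficient. -/
def wordLarge (α Q : ℝ) (N : ℕ) (L : List (ℤ × ℂ)) (j : ℕ) : Finset ℤ :=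
  (Finset.Icc 1 (N : ℤ)).filter fun n =>
    (1 / 2 : ℝ) ^ j * (1 + wordEnergy α Q L) < ‖fcoef (wordGrad α Q L) n‖

section Words

variable {α Q : ℝ}

lemma wordSum_cons (v : ℤ × ℂ) (L : List (ℤ × ℂ)) (x : ℝ) :
    wordSum (v :: L) x = wordSum L x + v.2 * fexp v.1 x := by
  simp [wordSum, add_comm]

@[fun_prop]
lemma continuous_wordSum (L : List (ℤ × ℂ)) : Continuous (wordSum L) := by
  induction L with
  | nil =>
    have : wordSum [] = fun _ => 0 := by
      ext x; simp [wordSum]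
    rw [this]
    exact continuous_const
  | cons v L ih =>
    have : wordSum (v :: L) = fun x => wordSum L x + v.2 * fexp v.1 x := by
      ext x; exact wordSum_cons v L x
    rw [this]
    fun_prop

lemma continuous_wordGrad (hα : 0 ≤ α) (L : List (ℤ × ℂ)) : Continuous (wordGrad α Q L) := by
  have := (continuous_truncWeight (Q := Q) hα).comp
    (show Continuous fun x => ‖wordSum L x‖ ^ 2 by fun_prop)
  unfold wordGrad
  exact (Complex.continuous_ofReal.comp this).mul (continuous_wordSum L)

lemma wordEnergy_nonneg (hα : 0 ≤ α) (hQ : 1 ≤ Q) (L : List (ℤ × ℂ)) : 0 ≤ wordEnergy α Q L :=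
  integral_nonneg fun _ => truncPow_nonneg hα hQ (by positivity)

lemma wordEnergy_nil : wordEnergy α Q [] = 0 := by
  simp [wordEnergy, wordSum, truncPow_zero]

lemma wordLarge_subset {N : ℕ} {L : List (ℤ × ℂ)} {j : ℕ} :
    wordLarge α Q N L j ⊆ Finset.Icc 1 (N : ℤ) := by
  unfold wordLarge
  exact Finset.filter_subset _ _

lemma mem_wordLarge {N : ℕ} {L : List (ℤ × ℂ)} {j : ℕ} {n : ℤ} :
    n ∈ wordLarge α Q N L j ↔ n ∈ Finset.Icc 1 (N : ℤ) ∧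
      (1 / 2 : ℝ) ^ j * (1 + wordEnergy α Q L) < ‖fcoef (wordGrad α Q L) n‖ := by
  unfold wordLarge
  rw [Finset.mem_filter]

lemma fcoef_wordGrad_nil (n : ℤ) : fcoef (wordGrad α Q []) n = 0 := by
  simp [fcoef, wordGrad, wordSum]

lemma integrable_truncPow_wordSum (hα : 0 ≤ α) (L : List (ℤ × ℂ)) :
    Integrable (fun x => truncPow α Q (‖wordSum L x‖ ^ 2)) unitMeasure :=
  integrable_unit_of_continuous ((continuous_truncPow hα).comp (by fun_prop))

lemma integrable_truncWeight_wordSum (hα : 0 ≤ α) (L : List (ℤ × ℂ)) :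
    Integrable (fun x => truncWeight α Q (‖wordSum L x‖ ^ 2)) unitMeasure :=
  integrable_unit_of_continuous ((continuous_truncWeight hα).comp (by fun_prop))

lemma card_wordLarge_le (hα : 0 ≤ α) (hQ : 1 ≤ Q) (N : ℕ) (L : List (ℤ × ℂ)) (j : ℕ) :
    ((wordLarge α Q N L j).card : ℝ) ≤ 2 ^ (1 + α) * 4 ^ j * Q ^ α := by
  set Ψ := wordEnergy α Q L with hΨ
  have hΨ0 : 0 ≤ Ψ := wordEnergy_nonneg hα hQ L
  have h1 : ∑ n ∈ wordLarge α Q N L j, ((1 / 2 : ℝ) ^ j * (1 + Ψ)) ^ 2 ≤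
      ∫ x, ‖wordGrad α Q L x‖ ^ 2 ∂unitMeasure := by
    refine (Finset.sum_le_sum fun n hn => ?_).trans
      (sum_norm_fcoef_sq_le (continuous_wordGrad hα L) (wordLarge α Q N L j))
    have := (mem_wordLarge.1 hn).2
    gcongr
  have h2 : ∫ x, ‖wordGrad α Q L x‖ ^ 2 ∂unitMeasure ≤ Q ^ α * 2 ^ (1 + α) * Ψ := by
    rw [hΨ, wordEnergy, ← integral_const_mul]
    refine integral_mono (integrable_unit_of_continuous ?_)
      ((integrable_truncPow_wordSum hα L).const_mul _) fun x => ?_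
    · have := continuous_wordGrad (Q := Q) hα L
      fun_prop
    · have := mul_truncWeight_sq_le hα hQ (s := ‖wordSum L x‖ ^ 2) (by positivity)
      have h0 := one_le_truncWeight hα hQ (a := ‖wordSum L x‖ ^ 2) (by positivity)
      refine le_trans (le_of_eq ?_) this
      simp only [wordGrad, norm_mul, Complex.norm_real]
      rw [Real.norm_of_nonneg (by linarith)]
      ring
  have h3 := h1.trans h2
  rw [Finset.sum_const, nsmul_eq_mul, mul_pow] at h3
  have hQα : 0 < Q ^ α * 2 ^ (1 + α) := by positivity
  have h4 : ((1 / 2 : ℝ) ^ j) ^ 2 * 4 ^ j = 1 := by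
    rw [← pow_mul, mul_comm j 2, pow_mul, ← mul_pow]; norm_num
  have h5 : ((wordLarge α Q N L j).card : ℝ) * ((1 / 2 : ℝ) ^ j) ^ 2 ≤ Q ^ α * 2 ^ (1 + α) := by
    have h6 : Ψ ≤ (1 + Ψ) ^ 2 := by nlinarith
    refine le_of_mul_le_mul_right ?_ (show 0 < (1 + Ψ) ^ 2 by positivity)
    calc ((wordLarge α Q N L j).card : ℝ) * ((1 / 2 : ℝ) ^ j) ^ 2 * (1 + Ψ) ^ 2
        ≤ Q ^ α * 2 ^ (1 + α) * Ψ := by linarith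
      _ ≤ _ := by gcongr
  calc ((wordLarge α Q N L j).card : ℝ)
      = ((wordLarge α Q N L j).card : ℝ) * (((1 / 2 : ℝ) ^ j) ^ 2 * 4 ^ j) := by
        rw [h4, mul_one]
    _ = ((wordLarge α Q N L j).card : ℝ) * ((1 / 2 : ℝ) ^ j) ^ 2 * 4 ^ j := by ring
    _ ≤ Q ^ α * 2 ^ (1 + α) * 4 ^ j := by gcongr
    _ = _ := by ring

/-- The growth constant of the energy under admissible steps. -/
def wordConst (α : ℝ) : ℝ := 2 + truncConst α * 2 ^ (1 + α)

lemma truncConst_nonneg (α : ℝ) : 0 ≤ truncConst α := by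
  unfold truncConst
  have : 0 ≤ max α 1 := le_max_of_le_right zero_le_one
  positivity

lemma wordConst_nonneg (α : ℝ) : 0 ≤ wordConst α := by
  have := truncConst_nonneg α
  unfold wordConst
  positivity

lemma integral_re_mul_conj_grad (hα : 0 ≤ α) (L : List (ℤ × ℂ)) (n : ℤ) (v : ℂ) :
    ∫ x, (v * fexp n x * starRingEnd ℂ (wordSum L x)).re *
      truncWeight α Q (‖wordSum L x‖ ^ 2) ∂unitMeasure =
      (v * starRingEnd ℂ (fcoef (wordGrad α Q L) n)).re := by
  rw [fcoef, ← integral_conj, ← integral_const_mul]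
  have e := integral_re (𝕜 := ℂ) (μ := unitMeasure)
    (f := fun x => v * starRingEnd ℂ (wordGrad α Q L x * starRingEnd ℂ (fexp n x)))
    (integrable_unit_of_continuous (by
      have h1 := Complex.continuous_conj
      have h2 := continuous_wordGrad (Q := Q) hα L
      fun_prop))
  refine Eq.trans ?_ e
  congr 1
  ext x
  simp only [wordGrad, map_mul, Complex.conj_ofReal, Complex.conj_conj, RCLike.re_to_complex]
  rw [show v * ((truncWeight α Q (‖wordSum L x‖ ^ 2) : ℂ) * starRingEnd ℂ (wordSum L x) *
    fexp n x) = (truncWeight α Q (‖wordSum L x‖ ^ 2) : ℂ) *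
      (v * fexp n x * starRingEnd ℂ (wordSum L x)) by ring, Complex.re_ofReal_mul, mul_comm]

lemma one_add_wordEnergy_cons_le (hα : 0 ≤ α) (hQ : 1 ≤ Q) (L : List (ℤ × ℂ)) (n : ℤ) (v : ℂ)
    (hv : ‖v‖ ≤ 1) (hn : ‖fcoef (wordGrad α Q L) n‖ ≤ ‖v‖ * (1 + wordEnergy α Q L)) :
    1 + wordEnergy α Q ((n, v) :: L) ≤
      (1 + wordEnergy α Q L) * (1 + wordConst α * ‖v‖ ^ 2) := by
  set Ψ := wordEnergy α Q L with hΨ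
  have hΨ0 : 0 ≤ Ψ := wordEnergy_nonneg hα hQ L
  have hcw := (continuous_truncWeight (Q := Q) hα).comp
    (show Continuous fun x => ‖wordSum L x‖ ^ 2 by fun_prop)
  have hi2 : Integrable (fun x => (v * fexp n x * starRingEnd ℂ (wordSum L x)).re *
      truncWeight α Q (‖wordSum L x‖ ^ 2)) unitMeasure := by
    refine integrable_unit_of_continuous (Continuous.mul ?_ hcw)
    have := Complex.continuous_conj
    have := Complex.continuous_re
    fun_prop
  have h1 : wordEnergy α Q ((n, v) :: L) ≤ Ψ +
      2 * (v * starRingEnd ℂ (fcoef (wordGrad α Q L) n)).re +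
      truncConst α * ‖v‖ ^ 2 * ∫ x, truncWeight α Q (‖wordSum L x‖ ^ 2) ∂unitMeasure := by
    have i12 : Integrable (fun x => truncPow α Q (‖wordSum L x‖ ^ 2) +
        2 * ((v * fexp n x * starRingEnd ℂ (wordSum L x)).re *
          truncWeight α Q (‖wordSum L x‖ ^ 2))) unitMeasure :=
      (integrable_truncPow_wordSum hα L).add (hi2.const_mul _)
    rw [← integral_re_mul_conj_grad hα, hΨ, wordEnergy, wordEnergy, ← integral_const_mul,
      ← integral_const_mul, ← integral_add (integrable_truncPow_wordSum hα L) (hi2.const_mul _),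
      ← integral_add i12 ((integrable_truncWeight_wordSum hα L).const_mul _)]
    refine integral_mono (integrable_truncPow_wordSum hα _)
      (i12.add ((integrable_truncWeight_wordSum hα L).const_mul _)) fun x => ?_
    have hnorm : ‖v * fexp n x‖ = ‖v‖ := by rw [norm_mul, norm_fexp, mul_one]
    have := truncPow_norm_add_sq_le hα hQ (wordSum L x) (v * fexp n x) (by rw [hnorm]; exact hv)
    rw [hnorm] at this
    simp only [wordSum_cons]
    linarith
  have h2 : ∫ x, truncWeight α Q (‖wordSum L x‖ ^ 2) ∂unitMeasure ≤ 2 ^ (1 + α) * (1 + Ψ) := by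
    have e : 2 ^ (1 + α) * (1 + Ψ) =
        ∫ x, 2 ^ (1 + α) * (1 + truncPow α Q (‖wordSum L x‖ ^ 2)) ∂unitMeasure := by
      rw [integral_const_mul, integral_add (integrable_const _) (integrable_truncPow_wordSum hα L),
        hΨ, wordEnergy]
      simp
    rw [e]
    exact integral_mono (integrable_truncWeight_wordSum hα L)
      (((integrable_const _).add (integrable_truncPow_wordSum hα L)).const_mul _)
      fun x => truncWeight_le_truncPow hα hQ (by positivity)
  have h3 : (v * starRingEnd ℂ (fcoef (wordGrad α Q L) n)).re ≤ ‖v‖ ^ 2 * (1 + Ψ) := by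
    refine (Complex.re_le_norm _).trans ?_
    rw [norm_mul, Complex.norm_conj]
    calc ‖v‖ * ‖fcoef (wordGrad α Q L) n‖ ≤ ‖v‖ * (‖v‖ * (1 + Ψ)) := by gcongr
      _ = _ := by ring
  have h4 : truncConst α * ‖v‖ ^ 2 * ∫ x, truncWeight α Q (‖wordSum L x‖ ^ 2) ∂unitMeasure ≤
      truncConst α * ‖v‖ ^ 2 * (2 ^ (1 + α) * (1 + Ψ)) := by
    have := truncConst_nonneg α
    gcongr
  unfold wordConst
  linarith

/-- An affine minorant of the energy, tangent at the function `G`. -/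
lemma tangent_le_wordEnergy (hα : 0 ≤ α) (hQ : 1 ≤ Q) {G : ℝ → ℂ} (hG : Continuous G)
    (L : List (ℤ × ℂ)) :
    (∫ x, truncPow α Q (‖G x‖ ^ 2) ∂unitMeasure) -
      2 * (∫ x, ‖G x‖ ^ 2 * truncWeight α Q (‖G x‖ ^ 2) ∂unitMeasure) +
      (L.map fun v => 2 * (v.2 * starRingEnd ℂ
        (fcoef (fun x => (truncWeight α Q (‖G x‖ ^ 2) : ℂ) * G x) v.1)).re).sum ≤
      wordEnergy α Q L := by
  have hcw := (continuous_truncWeight (Q := Q) hα).comp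
    (show Continuous fun x => ‖G x‖ ^ 2 by fun_prop)
  have hcp := (continuous_truncPow (Q := Q) hα).comp
    (show Continuous fun x => ‖G x‖ ^ 2 by fun_prop)
  set Γ : ℝ → ℂ := fun x => (truncWeight α Q (‖G x‖ ^ 2) : ℂ) * G x with hΓ
  have hΓc : Continuous Γ := (Complex.continuous_ofReal.comp hcw).mul hG
  have hre : ∀ L : List (ℤ × ℂ), (L.map fun v => 2 * (v.2 * starRingEnd ℂ (fcoef Γ v.1)).re).sum =
      2 * ∫ x, (wordSum L x * starRingEnd ℂ (Γ x)).re ∂unitMeasure := by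
    intro L
    induction L with
    | nil => simp [wordSum]
    | cons v L ih =>
      have hc := Complex.continuous_conj
      have hr := Complex.continuous_re
      have hadd : ∫ x, (wordSum (v :: L) x * starRingEnd ℂ (Γ x)).re ∂unitMeasure =
          ∫ x, (wordSum L x * starRingEnd ℂ (Γ x)).re ∂unitMeasure +
          ∫ x, (v.2 * fexp v.1 x * starRingEnd ℂ (Γ x)).re ∂unitMeasure := by
        rw [← integral_add (integrable_unit_of_continuous (by fun_prop))
          (integrable_unit_of_continuous (by fun_prop))]
        congr 1
        ext x
        rw [wordSum_cons, add_mul, Complex.add_re]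
      have hv : ∫ x, (v.2 * fexp v.1 x * starRingEnd ℂ (Γ x)).re ∂unitMeasure =
          (v.2 * starRingEnd ℂ (fcoef Γ v.1)).re := by
        rw [integral_re_mul_conj (by fun_prop) hΓc, fcoef, ← integral_conj, ← integral_const_mul]
        congr 2
        ext x
        simp only [map_mul, Complex.conj_conj]
        ring
      rw [List.map_cons, List.sum_cons, ih, hadd, hv]
      ring
  rw [hre, wordEnergy, ← integral_const_mul, ← integral_const_mul]
  have hc := Complex.continuous_conj
  have hr := Complex.continuous_re
  have i1 : Integrable (fun x => truncPow α Q (‖G x‖ ^ 2)) unitMeasure :=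
    integrable_unit_of_continuous hcp
  have i2 : Integrable (fun x => 2 * (‖G x‖ ^ 2 * truncWeight α Q (‖G x‖ ^ 2))) unitMeasure :=
    integrable_unit_of_continuous
      (continuous_const.mul ((show Continuous fun x => ‖G x‖ ^ 2 by fun_prop).mul hcw))
  have i3 : Integrable (fun x => 2 * (wordSum L x * starRingEnd ℂ (Γ x)).re) unitMeasure :=
    integrable_unit_of_continuous (by fun_prop)
  have i12 : Integrable (fun x => truncPow α Q (‖G x‖ ^ 2) -
      2 * (‖G x‖ ^ 2 * truncWeight α Q (‖G x‖ ^ 2))) unitMeasure := i1.sub i2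
  rw [← integral_sub i1 i2, ← integral_add i12 i3]
  refine integral_mono (i12.add i3) (integrable_truncPow_wordSum hα L) fun x => ?_
  have h1 := truncPow_subgradient hα hQ (a := ‖G x‖ ^ 2) (b := ‖wordSum L x‖ ^ 2)
    (by positivity) (by positivity)
  have h2 : (wordSum L x * starRingEnd ℂ (Γ x)).re =
      truncWeight α Q (‖G x‖ ^ 2) * (wordSum L x * starRingEnd ℂ (G x)).re := by
    rw [hΓ]
    simp only [map_mul, Complex.conj_ofReal]
    rw [mul_left_comm, Complex.re_ofReal_mul]
  have h3 : 2 * (wordSum L x * starRingEnd ℂ (G x)).re ≤ ‖wordSum L x‖ ^ 2 + ‖G x‖ ^ 2 := by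
    have h4 := (Complex.re_le_norm (wordSum L x * starRingEnd ℂ (G x)))
    rw [norm_mul, Complex.norm_conj] at h4
    nlinarith [sq_nonneg (‖wordSum L x‖ - ‖G x‖)]
  have h5 := one_le_truncWeight hα hQ (a := ‖G x‖ ^ 2) (by positivity)
  simp only [h2]
  nlinarith

end Words

/-- A system of coefficients with dyadic moduli on a subset of a random-like set `S` admits
weights `γ`, close to `1` on average, for which the truncated `L^p` energy is bounded. -/
lemma exists_weights_energy_le {α Q C y ε : ℝ} (hα : 0 ≤ α) (hQ : 1 ≤ Q) (hC : 1 ≤ C)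
    (hy : 0 ≤ y) (hε : 0 < ε) (hε1 : ε ≤ 1) {N J : ℕ} {S : Finset ℤ}
    (hSN : S ⊆ Finset.Icc 1 (N : ℤ)) {Vs : Finset (ℤ × ℂ)}
    (hS : ∀ L : List (ℤ × ℂ), L ≠ [] → L.length ≤ N → (∀ v ∈ L, v ∈ Vs) → ∀ j ≤ J,
      ((S ∩ wordLarge α Q N L j).card : ℝ) ≤ C * (L.length + 4 ^ j * y))
    {A : Finset ℤ} (hA : A ⊆ S) {lev : ℤ → ℕ} {b : ℤ → ℂ}
    (hb : ∀ n ∈ A, ‖b n‖ = (1 / 2) ^ lev n) (hlev : ∀ n ∈ A, lev n ≤ J)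
    (hV : ∀ n ∈ A, (n, b n) ∈ Vs) (hsum : ∑ n ∈ A, (1 / 4 : ℝ) ^ lev n ≤ 1) :
    ∃ γ : ℤ → ℝ, (∀ n ∈ A, 0 ≤ γ n ∧ γ n ≤ 1) ∧
      ∑ n ∈ A, (1 / 4 : ℝ) ^ lev n * (1 - γ n) ≤ C * (4 / 3 * ε + (J + 1) * y) ∧
      1 + ∫ x, truncPow α Q (‖trig (fun n => ε * (γ n * b n)) A x‖ ^ 2) ∂unitMeasure ≤
        Real.exp (wordConst α * ε) := by
  set w : List ℤ → List (ℤ × ℂ) := fun L => L.map fun n => (n, b n) with hw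
  set Φ : List ℤ → ℝ := fun L => 1 + wordEnergy α Q (w L) with hΦ
  have hΦ1 : ∀ L, 1 ≤ Φ L := fun L => by
    have := wordEnergy_nonneg hα hQ (w L)
    simp only [hΦ]; linarith
  have hquarter : ∀ n ∈ A, ‖b n‖ ^ 2 = (1 / 4 : ℝ) ^ lev n := by
    intro n hn
    rw [hb n hn, ← pow_mul, mul_comm, pow_mul]
    norm_num
  obtain ⟨γ, hγ, hγs, hJ⟩ := exists_selection (A := A) (lev := lev)
    (good := fun n L => ‖fcoef (wordGrad α Q (w L)) n‖ ≤ ‖b n‖ * Φ L) J hlev hsum Φ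
    (fun L => zero_le_one.trans (hΦ1 L)) (K := wordConst α) (wordConst_nonneg α)
    (by
      intro L n hn hg
      have := one_add_wordEnergy_cons_le hα hQ (w L) n (b n)
        (by rw [hb n hn]; exact pow_le_one₀ (by norm_num) (by norm_num)) hg
      rw [hquarter n hn] at this
      exact this)
    (C := C) (y := y) (ε := ε) (by linarith) hε hε1
    (by
      intro L hL j hj B hBA hB
      rcases eq_or_ne L [] with rfl | hLne
      · have : B = ∅ := by
          refine Finset.eq_empty_of_forall_notMem fun n hn => (hB n hn).2 ?_
          simp only [hw, List.map_nil, fcoef_wordGrad_nil, norm_zero]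
          have := hΦ1 []
          positivity
        simp only [this, Finset.card_empty, Nat.cast_zero]
        positivity
      by_cases hLN : L.length ≤ N
      · have h1 : B ⊆ S ∩ wordLarge α Q N (w L) j := by
          intro n hn
          have hnA := hBA hn
          refine Finset.mem_inter.2 ⟨hA hnA, mem_wordLarge.2 ⟨hSN (hA hnA), ?_⟩⟩
          have h2 := hB n hn
          rw [← h2.1, ← hb n hnA]
          exact not_le.1 h2.2
        have h2 := hS (w L) (by simpa [hw] using hLne) (by simpa [hw] using hLN) (by
          intro v hv
          obtain ⟨n, hn, rfl⟩ := List.mem_map.1 hv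
          exact hV n (hL n hn)) j hj
        simp only [hw, List.length_map] at h2
        refine le_trans ?_ h2
        exact_mod_cast Finset.card_le_card h1
      · have h1 : B.card ≤ N := by
          have := Finset.card_le_card ((hBA.trans hA).trans hSN)
          simpa using this
        have h2 : (B.card : ℝ) ≤ L.length := by exact_mod_cast h1.trans (not_le.1 hLN).le
        have h3 : 0 ≤ (4 : ℝ) ^ j * y := by positivity
        nlinarith [(Nat.cast_nonneg L.length : (0 : ℝ) ≤ L.length)])
  refine ⟨γ, hγ, hγs, ?_⟩
  set G := trig (fun n => (ε : ℂ) * (γ n * b n)) A with hG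
  have hGc : Continuous G := continuous_trig _ _
  set Γ : ℝ → ℂ := fun x => (truncWeight α Q (‖G x‖ ^ 2) : ℂ) * G x with hΓ
  have hΓc : Continuous Γ := (Complex.continuous_ofReal.comp
    ((continuous_truncWeight hα).comp (by fun_prop))).mul hGc
  have key := hJ (1 + ((∫ x, truncPow α Q (‖G x‖ ^ 2) ∂unitMeasure) -
      2 * (∫ x, ‖G x‖ ^ 2 * truncWeight α Q (‖G x‖ ^ 2) ∂unitMeasure)))
    (fun n => 2 * (b n * starRingEnd ℂ (fcoef Γ n)).re) (by
      intro L _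
      have := tangent_le_wordEnergy hα hQ hGc (w L)
      rw [hw, List.map_map] at this
      simp only [hΦ, hw]
      simp only [Function.comp_def] at this
      linarith)
  have hpair : ε * ∑ n ∈ A, γ n * (2 * (b n * starRingEnd ℂ (fcoef Γ n)).re) =
      2 * ∫ x, ‖G x‖ ^ 2 * truncWeight α Q (‖G x‖ ^ 2) ∂unitMeasure := by
    have h1 := integral_mul_conj_trig hΓc (fun n => (ε : ℂ) * (γ n * b n)) A
    have h2 : ∫ x, Γ x * starRingEnd ℂ (trig (fun n => (ε : ℂ) * (γ n * b n)) A x) ∂unitMeasure =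
        ((∫ x, ‖G x‖ ^ 2 * truncWeight α Q (‖G x‖ ^ 2) ∂unitMeasure : ℝ) : ℂ) := by
      rw [← integral_complex_ofReal]
      congr 1
      ext x
      simp only [hΓ, ← hG]
      rw [mul_assoc, Complex.mul_conj, Complex.normSq_eq_norm_sq]
      push_cast
      ring
    have h3 := congrArg Complex.re (h2.symm.trans h1)
    rw [Complex.ofReal_re, Complex.re_sum] at h3
    rw [h3, Finset.mul_sum, Finset.mul_sum]
    refine Finset.sum_congr rfl fun n _ => ?_
    simp only [map_mul, Complex.conj_ofReal]
    rw [mul_assoc, Complex.re_ofReal_mul, mul_assoc, Complex.re_ofReal_mul]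
    have : (starRingEnd ℂ (b n) * fcoef Γ n).re = (b n * starRingEnd ℂ (fcoef Γ n)).re := by
      rw [← Complex.conj_re (b n * _)]
      simp
    rw [this]
    ring
  rw [hpair] at key
  have h0 : Φ [] = 1 := by simp [hΦ, hw, wordEnergy_nil]
  rw [h0] at key
  linarith

section TrigNorm

variable {p : ℝ}

/-- The `L^p` norm of a trigonometric polynomial on the unit interval. -/
def trigNorm (p : ℝ) (a : ℤ → ℂ) (S : Finset ℤ) : ℝ :=
  lpNorm (trig a S) (ENNReal.ofReal p) unitMeasure

/-- `K` bounds the `L^p` norm of the trigonometric polynomials with frequencies in `S` and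
coefficients of `ℓ²` norm at most `1`. -/
def TrigBound (p : ℝ) (S : Finset ℤ) (K : ℝ) : Prop :=
  ∀ a : ℤ → ℂ, ∑ n ∈ S, ‖a n‖ ^ 2 ≤ 1 → trigNorm p a S ≤ K

lemma trigNorm_eq (hp : 0 < p) (a : ℤ → ℂ) (S : Finset ℤ) :
    trigNorm p a S = (∫ x, ‖trig a S x‖ ^ p ∂unitMeasure) ^ (1 / p) := by
  rw [trigNorm, lpNorm_eq_integral_norm_rpow_toReal (by simpa using hp) ENNReal.ofReal_ne_top
    (continuous_trig a S).aestronglyMeasurable, ENNReal.toReal_ofReal hp.le, one_div]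

lemma trigNorm_nonneg (a : ℤ → ℂ) (S : Finset ℤ) : 0 ≤ trigNorm p a S := lpNorm_nonneg

lemma trig_add (a b : ℤ → ℂ) (S : Finset ℤ) (x : ℝ) :
    trig (fun n => a n + b n) S x = trig a S x + trig b S x := by
  simp [trig, add_mul, Finset.sum_add_distrib]

lemma trig_const_mul (c : ℂ) (a : ℤ → ℂ) (S : Finset ℤ) (x : ℝ) :
    trig (fun n => c * a n) S x = c * trig a S x := by
  simp [trig, Finset.mul_sum, mul_assoc]

lemma memLp_trig (a : ℤ → ℂ) (S : Finset ℤ) (q : ENNReal) : MemLp (trig a S) q unitMeasure := by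
  refine MemLp.of_bound (continuous_trig a S).aestronglyMeasurable (∑ n ∈ S, ‖a n‖)
    (Filter.Eventually.of_forall fun x => (norm_sum_le _ _).trans (le_of_eq ?_))
  simp [norm_fexp]

lemma trigNorm_add_le (hp : 1 ≤ p) (a b : ℤ → ℂ) (S : Finset ℤ) :
    trigNorm p (fun n => a n + b n) S ≤ trigNorm p a S + trigNorm p b S := by
  have : trig (fun n => a n + b n) S = trig a S + trig b S := by
    ext x; exact trig_add a b S x
  rw [trigNorm, this]
  exact lpNorm_add_le (memLp_trig a S _) (by simpa using hp)

lemma trigNorm_const_mul (c : ℂ) (a : ℤ → ℂ) (S : Finset ℤ) :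
    trigNorm p (fun n => c * a n) S = ‖c‖ * trigNorm p a S := by
  have : trig (fun n => c * a n) S = c • trig a S := by
    ext x; exact trig_const_mul c a S x
  rw [trigNorm, this, lpNorm_const_smul]
  rfl

lemma trigNorm_congr {a b : ℤ → ℂ} {S : Finset ℤ} (h : ∀ n ∈ S, a n = b n) :
    trigNorm p a S = trigNorm p b S := by
  have : trig a S = trig b S := by
    ext x
    exact Finset.sum_congr rfl fun n hn => by rw [h n hn]
  rw [trigNorm, this, trigNorm]

lemma TrigBound.trigNorm_le {S : Finset ℤ} {K : ℝ} (h : TrigBound p S K) {r : ℝ} (hr : 0 < r)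
    {a : ℤ → ℂ} (ha : ∑ n ∈ S, ‖a n‖ ^ 2 ≤ r ^ 2) : trigNorm p a S ≤ r * K := by
  have h1 := h (fun n => (r : ℂ)⁻¹ * a n) (by
    simp only [norm_mul, norm_inv, Complex.norm_real, Real.norm_of_nonneg hr.le, mul_pow,
      ← Finset.mul_sum]
    rw [inv_pow, inv_mul_le_iff₀ (by positivity), mul_one]
    exact ha)
  rw [trigNorm_const_mul, norm_inv, Complex.norm_real, Real.norm_of_nonneg hr.le,
    inv_mul_le_iff₀ hr] at h1
  exact h1

lemma TrigBound.nonneg {S : Finset ℤ} {K : ℝ} (h : TrigBound p S K) : 0 ≤ K :=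
  (trigNorm_nonneg _ _).trans (h (fun _ => 0) (by simp))

lemma norm_trig_sq_le (a : ℤ → ℂ) (S : Finset ℤ) (ha : ∑ n ∈ S, ‖a n‖ ^ 2 ≤ 1) (x : ℝ) :
    ‖trig a S x‖ ^ 2 ≤ S.card := by
  have h1 : ‖trig a S x‖ ≤ ∑ n ∈ S, 1 * ‖a n‖ := by
    refine (norm_sum_le _ _).trans (le_of_eq ?_)
    simp [norm_fexp]
  calc ‖trig a S x‖ ^ 2 ≤ (∑ n ∈ S, 1 * ‖a n‖) ^ 2 := by gcongr
    _ ≤ (∑ _n ∈ S, (1 : ℝ) ^ 2) * ∑ n ∈ S, ‖a n‖ ^ 2 := Finset.sum_mul_sq_le_sq_mul_sq _ _ _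
    _ ≤ S.card * 1 := by
      simp only [one_pow, Finset.sum_const, nsmul_eq_mul, mul_one]
      have : (0 : ℝ) ≤ S.card := by positivity
      nlinarith
    _ = S.card := mul_one _

lemma trigBound_card (hp : 0 < p) (S : Finset ℤ) : TrigBound p S (S.card + 1) := by
  intro a ha
  rw [trigNorm_eq hp]
  have h1 : ∫ x, ‖trig a S x‖ ^ p ∂unitMeasure ≤ ∫ _x, ((S.card : ℝ) + 1) ^ p ∂unitMeasure := by
    refine integral_mono (integrable_unit_of_continuous
      ((continuous_trig a S).norm.rpow_const fun _ => Or.inr hp.le))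
      (integrable_const _) fun x => ?_
    have h2 := norm_trig_sq_le a S ha x
    have h3 : (0 : ℝ) ≤ S.card := by positivity
    exact Real.rpow_le_rpow (norm_nonneg _) (by nlinarith [norm_nonneg (trig a S x)]) hp.le
  rw [integral_const, probReal_univ, one_smul] at h1
  calc _ ≤ (((S.card : ℝ) + 1) ^ p) ^ (1 / p) :=
        Real.rpow_le_rpow (integral_nonneg fun _ => by positivity) h1 (by positivity)
    _ = _ := by rw [← Real.rpow_mul (by positivity), mul_one_div_cancel hp.ne', Real.rpow_one]

/-- If every unit sequence splits as a part with `L^p` norm at most `D` plus two remainders small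
in `ℓ²`, then the `L^p` bound self-improves to a multiple of `D`. -/
lemma trigBound_of_decomposition (hp : 1 ≤ p) {S : Finset ℤ} {D : ℝ}
    (hdec : ∀ a : ℤ → ℂ, ∑ n ∈ S, ‖a n‖ ^ 2 ≤ 1 → ∃ v r s : ℤ → ℂ,
      (∀ n ∈ S, a n = v n + (r n + s n)) ∧ trigNorm p v S ≤ D ∧
      ∑ n ∈ S, ‖r n‖ ^ 2 ≤ (1 / 20) ^ 2 ∧ ∑ n ∈ S, ‖s n‖ ^ 2 ≤ (87 / 100) ^ 2) :
    TrigBound p S (25 / 2 * D) := by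
  have hstep : ∀ K, TrigBound p S K → TrigBound p S (D + 23 / 25 * K) := by
    intro K hK a ha
    obtain ⟨v, r, s, h1, h2, h3, h4⟩ := hdec a ha
    rw [trigNorm_congr h1]
    have h5 := hK.trigNorm_le (by norm_num) h3
    have h6 := hK.trigNorm_le (by norm_num) h4
    have h7 := trigNorm_add_le hp v (fun n => r n + s n) S
    have h8 := trigNorm_add_le hp r s S
    linarith
  have hiter : ∀ k : ℕ, TrigBound p S (25 / 2 * D + (23 / 25) ^ k * (S.card + 1 - 25 / 2 * D)) := by
    intro k
    induction k with
    | zero =>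
      have := trigBound_card (p := p) (by linarith) S
      simpa using this
    | succ k ih =>
      have := hstep _ ih
      convert this using 1
      ring
  intro a ha
  have hlim : Filter.Tendsto (fun k : ℕ => 25 / 2 * D + (23 / 25 : ℝ) ^ k *
      (S.card + 1 - 25 / 2 * D)) Filter.atTop (nhds (25 / 2 * D)) := by
    have := ((tendsto_pow_atTop_nhds_zero_of_lt_one (r := (23 / 25 : ℝ)) (by norm_num)
      (by norm_num)).mul_const ((S.card : ℝ) + 1 - 25 / 2 * D)).const_add (25 / 2 * D)
    simpa using this
  exact ge_of_tendsto' hlim fun k => hiter k a ha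

lemma TrigBound.hasLambdaBound (hp : 0 < p) {S : Finset ℤ} {K : ℝ} (h : TrigBound p S K) :
    HasLambdaBound (S : Set ℤ) p K := by
  intro a ha
  have hsub : a.support ⊆ S := by
    intro n hn
    by_contra hnS
    exact (Finsupp.mem_support_iff.1 hn) (ha n (by simpa using hnS))
  have hsum : ∑ n ∈ a.support, ‖a n‖ ^ 2 = ∑ n ∈ S, ‖a n‖ ^ 2 :=
    Finset.sum_subset hsub fun n _ hn => by rw [Finsupp.notMem_support_iff.1 hn]; simp
  have hexp : expSum a = trig a S := by
    ext x
    unfold expSum trig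
    rw [Finset.sum_subset hsub fun n _ hn => by rw [Finsupp.notMem_support_iff.1 hn]; simp]
    rfl
  have h1 := trigNorm_eq hp a S
  rw [hexp, hsum, ← h1]
  set w := ∑ n ∈ S, ‖a n‖ ^ 2 with hw
  have hw0 : 0 ≤ w := Finset.sum_nonneg fun _ _ => by positivity
  rcases hw0.eq_or_lt with h0 | h0
  · have hz : ∀ n ∈ S, a n = (0 : ℂ) * a n := by
      intro n hn
      have := (Finset.sum_eq_zero_iff_of_nonneg fun _ _ => by positivity).1 h0.symm n hn
      have : a n = 0 := by simpa using this
      simp [this]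
    rw [trigNorm_congr hz, trigNorm_const_mul, norm_zero, zero_mul]
    exact mul_nonneg h.nonneg (Real.rpow_nonneg hw0 _)
  · rw [← Real.sqrt_eq_rpow, mul_comm]
    exact h.trigNorm_le (Real.sqrt_pos.2 h0) (by rw [Real.sq_sqrt hw0])

end TrigNorm

lemma mul_rpow_le_truncPow {α Q e t : ℝ} (hα : 0 ≤ α) (hQ : 1 ≤ Q) (he : 0 < e) (ht : 0 ≤ t) :
    t * t ^ α ≤ (2 / e) ^ (1 + α) * truncPow α Q (e * t) + t * excess α (Q / e) t := by
  have h1 : min t (Q / e) = 1 / e * min (e * t) Q := by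
    rw [mul_min_of_nonneg _ _ (by positivity)]
    congr 1
    · field_simp
    · ring
  have h2 : (min t (Q / e)) ^ α ≤ (1 / e) ^ α * truncWeight α Q (e * t) := by
    rw [h1, Real.mul_rpow (by positivity) (le_min (by positivity) (by linarith)), truncWeight]
    refine mul_le_mul_of_nonneg_left (Real.rpow_le_rpow (le_min (by positivity) (by linarith))
      (min_le_min_right _ (by linarith)) hα) (by positivity)
  have h3 := mul_truncWeight_le hα hQ (s := e * t) (by positivity)
  have h4 : (2 / e) ^ (1 + α) = 1 / e * (1 / e) ^ α * 2 ^ (1 + α) := by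
    rw [div_eq_mul_one_div, Real.mul_rpow (by norm_num) (by positivity),
      Real.rpow_one_add' (x := 1 / e) (by positivity) (by positivity)]
    ring
  have h5 : t * t ^ α = t * (min t (Q / e)) ^ α + t * excess α (Q / e) t := by
    unfold excess; ring
  rw [h5, h4]
  refine add_le_add_left ?_ _
  calc t * (min t (Q / e)) ^ α ≤ t * ((1 / e) ^ α * truncWeight α Q (e * t)) := by gcongr
    _ = 1 / e * (1 / e) ^ α * (e * t * truncWeight α Q (e * t)) := by field_simp
    _ ≤ 1 / e * (1 / e) ^ α * (2 ^ (1 + α) * truncPow α Q (e * t)) := by gcongr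
    _ = _ := by ring

lemma trigNorm_le_of_energy {α Q δ B M E ε : ℝ} (hα : 0 ≤ α) (hQ : 1 ≤ Q) (hδ : 0 ≤ δ)
    (hε : 0 < ε) (hε1 : ε ≤ 1) (hBQ : B ≤ Q / 2) {S T : Finset ℤ} (hST : S ⊆ T)
    (hB : ∀ x, ‖∑ n ∈ S, fexp n x - δ * ∑ n ∈ T, fexp n x‖ ≤ B) (hM : (S.card : ℝ) ≤ M)
    (c : ℤ → ℂ) (hc : ∑ n ∈ S, ‖c n‖ ^ 2 ≤ 1)
    (hE : ∫ x, truncPow α Q (‖trig (fun n => ε * c n) S x‖ ^ 2) ∂unitMeasure ≤ E) :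
    trigNorm (2 * (1 + α)) c S ≤
      ((2 / ε ^ 2) ^ (1 + α) * E + 2 * δ * M ^ α) ^ (1 / (2 * (1 + α))) := by
  have hε2 : 0 < ε ^ 2 := by positivity
  have hε21 : ε ^ 2 ≤ 1 := pow_le_one₀ hε.le hε1
  have hQe : Q ≤ Q / ε ^ 2 := by
    rw [le_div_iff₀ hε2]
    nlinarith
  have hexc := integral_mul_excess_le (Q := Q / ε ^ 2) hα (by positivity) hδ (by linarith) hST hB c
    hc fun x => (norm_trig_sq_le c S hc x).trans hM
  rw [trigNorm_eq (by positivity)]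
  refine Real.rpow_le_rpow (integral_nonneg fun _ => by positivity) ?_ (by positivity)
  have hf := continuous_trig c S
  have hg := continuous_trig (fun n => ε * c n) S
  have i1 : Integrable (fun x => truncPow α Q (‖trig (fun n => ε * c n) S x‖ ^ 2)) unitMeasure :=
    integrable_unit_of_continuous ((continuous_truncPow hα).comp (by fun_prop))
  have i2 : Integrable (fun x => ‖trig c S x‖ ^ 2 * excess α (Q / ε ^ 2) (‖trig c S x‖ ^ 2))
      unitMeasure :=
    integrable_unit_of_continuous ((show Continuous fun x => ‖trig c S x‖ ^ 2 by fun_prop).mul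
      ((continuous_excess hα).comp (by fun_prop)))
  calc ∫ x, ‖trig c S x‖ ^ (2 * (1 + α)) ∂unitMeasure
      ≤ ∫ x, ((2 / ε ^ 2) ^ (1 + α) * truncPow α Q (‖trig (fun n => ε * c n) S x‖ ^ 2) +
          ‖trig c S x‖ ^ 2 * excess α (Q / ε ^ 2) (‖trig c S x‖ ^ 2)) ∂unitMeasure := by
        refine integral_mono (integrable_unit_of_continuous
          (hf.norm.rpow_const fun _ => Or.inr (by positivity))) ((i1.const_mul _).add i2)
          fun x => ?_
        have h1 := mul_rpow_le_truncPow hα hQ hε2 (t := ‖trig c S x‖ ^ 2) (by positivity)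
        have h2 : ‖trig (fun n => ε * c n) S x‖ ^ 2 = ε ^ 2 * ‖trig c S x‖ ^ 2 := by
          rw [trig_const_mul, norm_mul, Complex.norm_real, Real.norm_of_nonneg hε.le, mul_pow]
        have h3 : ‖trig c S x‖ ^ (2 * (1 + α)) =
            ‖trig c S x‖ ^ 2 * (‖trig c S x‖ ^ 2) ^ α := by
          rw [Real.rpow_mul (norm_nonneg _), Real.rpow_two]
          exact Real.rpow_one_add' (by positivity) (by positivity)
        simp only [h2, h3]
        exact h1
    _ = (2 / ε ^ 2) ^ (1 + α) *
          (∫ x, truncPow α Q (‖trig (fun n => ε * c n) S x‖ ^ 2) ∂unitMeasure) +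
        ∫ x, ‖trig c S x‖ ^ 2 * excess α (Q / ε ^ 2) (‖trig c S x‖ ^ 2) ∂unitMeasure := by
        rw [integral_add (i1.const_mul _) i2, integral_const_mul]
    _ ≤ _ := by gcongr

lemma exists_rounding (J : ℕ) (z : ℂ) (hz : ‖z‖ ≤ 1) :
    ‖z‖ ^ 2 ≤ (1 / 4 : ℝ) ^ J ∨ ∃ j ≤ J, ∃ d < 4, (1 / 2 : ℝ) ^ j ≤ ‖z‖ ∧
      ‖z - (1 / 2 : ℂ) ^ j * Complex.I ^ d‖ ^ 2 ≤ 5 / 8 * ‖z‖ ^ 2 := by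
  by_cases hJ : ‖z‖ < (1 / 2 : ℝ) ^ J
  · left
    calc ‖z‖ ^ 2 ≤ ((1 / 2 : ℝ) ^ J) ^ 2 := by gcongr
      _ = (1 / 4 : ℝ) ^ J := by rw [← pow_mul, mul_comm, pow_mul]; norm_num
  right
  classical
  have hex : ∃ j, (1 / 2 : ℝ) ^ j ≤ ‖z‖ := ⟨J, not_lt.1 hJ⟩
  set j := Nat.find hex with hj
  have h1 : (1 / 2 : ℝ) ^ j ≤ ‖z‖ := Nat.find_spec hex
  have h2 : ‖z‖ ≤ 2 * (1 / 2 : ℝ) ^ j := by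
    rcases Nat.eq_zero_or_pos j with h | h
    · rw [h]; linarith [hz]
    · have := not_le.1 (Nat.find_min hex (Nat.sub_lt h one_pos))
      have e : (1 / 2 : ℝ) ^ j = (1 / 2) ^ (j - 1) * (1 / 2) := by
        rw [← pow_succ, Nat.sub_add_cancel h]
      linarith
  refine ⟨j, Nat.find_min' hex (not_lt.1 hJ), ?_⟩
  set ρ := (1 / 2 : ℝ) ^ j with hρ
  have hρ0 : 0 < ρ := by positivity
  have hρc : (1 / 2 : ℂ) ^ j = (ρ : ℂ) := by rw [hρ]; push_cast; rfl
  have hnorm : ‖z‖ ^ 2 = z.re ^ 2 + z.im ^ 2 := by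
    rw [← Complex.normSq_eq_norm_sq, Complex.normSq_apply]; ring
  have hmain : ∀ m : ℝ, 0 ≤ m → ‖z‖ ^ 2 ≤ 2 * m ^ 2 →
      ‖z‖ ^ 2 + ρ ^ 2 - 2 * ρ * m ≤ 5 / 8 * ‖z‖ ^ 2 := by
    intro m hm hzm
    have h3 : 7 / 10 * ‖z‖ ≤ m := by
      refine le_of_sq_le_sq ?_ hm
      nlinarith [sq_nonneg ‖z‖]
    nlinarith [mul_le_mul_of_nonneg_left h3 hρ0.le,
      mul_nonneg (sub_nonneg.2 h1) (sub_nonneg.2 h2)]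
  rw [hρc]
  have hdist : ∀ w : ℂ, ‖z - ρ * w‖ ^ 2 = (z.re - ρ * w.re) ^ 2 + (z.im - ρ * w.im) ^ 2 := by
    intro w
    rw [← Complex.normSq_eq_norm_sq, Complex.normSq_apply]
    simp
    ring
  have hcases : |z.im| ≤ |z.re| ∨ |z.re| ≤ |z.im| := le_total _ _
  rcases hcases with h | h
  · have h' := sq_le_sq.2 h
    rcases le_total 0 z.re with h0 | h0
    · refine ⟨0, by norm_num, h1, ?_⟩
      rw [hdist]
      simp only [pow_zero, Complex.one_re, Complex.one_im]
      have := hmain z.re h0 (by rw [hnorm]; linarith)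
      linarith
    · refine ⟨2, by norm_num, h1, ?_⟩
      rw [hdist]
      simp only [Complex.I_sq, Complex.neg_re, Complex.neg_im, Complex.one_re, Complex.one_im]
      have := hmain (-z.re) (by linarith) (by rw [hnorm]; linarith)
      linarith
  · have h' := sq_le_sq.2 h
    rcases le_total 0 z.im with h0 | h0
    · refine ⟨1, by norm_num, h1, ?_⟩
      rw [hdist]
      simp only [pow_one, Complex.I_re, Complex.I_im]
      have := hmain z.im h0 (by rw [hnorm]; linarith)
      linarith
    · refine ⟨3, by norm_num, h1, ?_⟩
      rw [hdist]
      simp only [Complex.I_pow_three, Complex.neg_re, Complex.neg_im, Complex.I_re, Complex.I_im]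
      have := hmain (-z.im) (by linarith) (by rw [hnorm]; linarith)
      linarith

lemma trigBound_of_card_wordLarge {α Q C y ε δ B M : ℝ} (hα : 0 ≤ α) (hQ : 1 ≤ Q) (hC : 1 ≤ C)
    (hy : 0 ≤ y) (hε : 0 < ε) (hε1 : ε ≤ 1) (hδ : 0 ≤ δ) (hBQ : B ≤ Q / 2) {N J : ℕ}
    {S : Finset ℤ} (hSN : S ⊆ Finset.Icc 1 (N : ℤ)) (hM : (S.card : ℝ) ≤ M)
    (hB : ∀ x, ‖∑ n ∈ S, fexp n x - δ * ∑ n ∈ Finset.Icc 1 (N : ℤ), fexp n x‖ ≤ B)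
    {Vs : Finset (ℤ × ℂ)}
    (hVs : ∀ n ∈ S, ∀ j ≤ J, ∀ d < 4, (n, (1 / 2 : ℂ) ^ j * Complex.I ^ d) ∈ Vs)
    (hS : ∀ L : List (ℤ × ℂ), L ≠ [] → L.length ≤ N → (∀ v ∈ L, v ∈ Vs) → ∀ j ≤ J,
      ((S ∩ wordLarge α Q N L j).card : ℝ) ≤ C * (L.length + 4 ^ j * y))
    (hsmall : C * (4 / 3 * ε + (J + 1) * y) ≤ (1 / 20) ^ 2)
    (htiny : (S.card : ℝ) * (1 / 4) ^ J ≤ 1 / 8) :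
    TrigBound (2 * (1 + α)) S (25 / 2 * ((2 / ε ^ 2) ^ (1 + α) * Real.exp (wordConst α * ε) +
      2 * δ * M ^ α) ^ (1 / (2 * (1 + α)))) := by
  classical
  refine trigBound_of_decomposition (by linarith) fun a ha => ?_
  have ha1 : ∀ n ∈ S, ‖a n‖ ≤ 1 := by
    intro n hn
    have := (Finset.single_le_sum (f := fun n => ‖a n‖ ^ 2) (fun _ _ => by positivity) hn).trans ha
    exact (sq_le_one_iff₀ (norm_nonneg _)).1 this
  set A := S.filter fun n => ¬ ‖a n‖ ^ 2 ≤ (1 / 4 : ℝ) ^ J with hA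
  have hAS : A ⊆ S := Finset.filter_subset _ _
  have hround : ∀ n, ∃ j d : ℕ, n ∈ A → j ≤ J ∧ d < 4 ∧ (1 / 2 : ℝ) ^ j ≤ ‖a n‖ ∧
      ‖a n - (1 / 2 : ℂ) ^ j * Complex.I ^ d‖ ^ 2 ≤ 5 / 8 * ‖a n‖ ^ 2 := by
    intro n
    by_cases hn : n ∈ A
    · obtain ⟨j, hj, d, hd, h⟩ := (exists_rounding J (a n) (ha1 n (hAS hn))).resolve_left
        (Finset.mem_filter.1 hn).2
      exact ⟨j, d, fun _ => ⟨hj, hd, h⟩⟩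
    · exact ⟨0, 0, fun h => absurd h hn⟩
  choose lev dir hround using hround
  set b : ℤ → ℂ := fun n => (1 / 2 : ℂ) ^ lev n * Complex.I ^ dir n with hb
  have hbn : ∀ n, ‖b n‖ = (1 / 2 : ℝ) ^ lev n := by
    intro n
    simp [hb]
  have hbn2 : ∀ n, ‖b n‖ ^ 2 = (1 / 4 : ℝ) ^ lev n := by
    intro n
    rw [hbn, ← pow_mul, mul_comm, pow_mul]
    norm_num
  have hbsum : ∑ n ∈ A, (1 / 4 : ℝ) ^ lev n ≤ 1 := by
    refine le_trans ?_ ha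
    refine (Finset.sum_le_sum fun n hn => ?_).trans
      (Finset.sum_le_sum_of_subset_of_nonneg hAS fun _ _ _ => by positivity)
    rw [← hbn2, hbn]
    have := (hround n hn).2.2.1
    gcongr
  obtain ⟨γ, hγ, hγsum, henergy⟩ := exists_weights_energy_le hα hQ hC hy hε hε1 hSN hS hAS
    (lev := lev) (b := b) (fun n _ => hbn n) (fun n hn => (hround n hn).1)
    (fun n hn => hVs n (hAS hn) _ (hround n hn).1 _ (hround n hn).2.1) hbsum
  set v : ℤ → ℂ := fun n => if n ∈ A then (γ n : ℂ) * b n else 0 with hv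
  set r : ℤ → ℂ := fun n => if n ∈ A then ((1 - γ n : ℝ) : ℂ) * b n else 0 with hr
  set s : ℤ → ℂ := fun n => if n ∈ A then a n - b n else a n with hs
  have hsumA : ∀ f : ℤ → ℝ, ∑ n ∈ S, (if n ∈ A then f n else 0) = ∑ n ∈ A, f n := by
    intro f
    rw [← Finset.sum_filter]
    congr 1
    ext n
    simp only [Finset.mem_filter]
    exact ⟨fun h => h.2, fun h => ⟨hAS h, h⟩⟩
  refine ⟨v, r, s, ?_, ?_, ?_, ?_⟩
  · intro n _
    simp only [hv, hr, hs]
    split_ifs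
    · push_cast; ring
    · ring
  · refine trigNorm_le_of_energy hα hQ hδ hε hε1 hBQ hSN hB hM v ?_ ?_
    · have h0 : ∑ n ∈ S, ‖v n‖ ^ 2 = ∑ n ∈ A, ‖(γ n : ℂ) * b n‖ ^ 2 := by
        rw [← hsumA]
        refine Finset.sum_congr rfl fun n _ => ?_
        simp only [hv]
        split_ifs <;> simp
      refine h0.trans_le ((Finset.sum_le_sum fun n hn => ?_).trans hbsum)
      · rw [norm_mul, mul_pow, hbn2, Complex.norm_real, Real.norm_of_nonneg (hγ n hn).1]
        have h1 := hγ n hn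
        have h2 : γ n ^ 2 ≤ 1 := pow_le_one₀ h1.1 h1.2
        exact mul_le_of_le_one_left (by positivity) h2
    · have h1 : trig (fun n => (ε : ℂ) * v n) S = trig (fun n => (ε : ℂ) * (γ n * b n)) A := by
        ext x
        unfold trig
        rw [← Finset.sum_subset hAS]
        · refine Finset.sum_congr rfl fun n hn => ?_
          simp only [hv, if_pos hn]
        · intro n _ hn
          simp only [hv, if_neg hn, mul_zero, zero_mul]
      rw [h1]
      linarith
  · refine le_trans ?_ (hγsum.trans hsmall)
    rw [← hsumA]
    refine Finset.sum_le_sum fun n _ => ?_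
    simp only [hr]
    split_ifs with hn
    · have h1 := hγ n hn
      rw [norm_mul, mul_pow, hbn2, Complex.norm_real, Real.norm_of_nonneg (by linarith), mul_comm]
      have h2 : (1 - γ n) ^ 2 ≤ 1 - γ n := by nlinarith
      gcongr
    · simp
  · calc ∑ n ∈ S, ‖s n‖ ^ 2 ≤ ∑ n ∈ S, (5 / 8 * ‖a n‖ ^ 2 + (1 / 4 : ℝ) ^ J) := by
          refine Finset.sum_le_sum fun n hn => ?_
          have h0 : (0 : ℝ) ≤ (1 / 4) ^ J := by positivity
          simp only [hs]
          split_ifs with hnA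
          · have := (hround n hnA).2.2.2
            simp only [hb]
            linarith
          · have : ‖a n‖ ^ 2 ≤ (1 / 4 : ℝ) ^ J := by
              by_contra hcon
              exact hnA (Finset.mem_filter.2 ⟨hn, hcon⟩)
            nlinarith [sq_nonneg ‖a n‖]
      _ ≤ 5 / 8 * 1 + 1 / 8 := by
          rw [Finset.sum_add_distrib, ← Finset.mul_sum, Finset.sum_const, nsmul_eq_mul]
          gcongr
      _ ≤ _ := by norm_num

section DenseSet

open Filter Topology

lemma eventually_natCast_rpow_le {a b c : ℝ} (hab : a < b) (hc : 0 < c) :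
    ∀ᶠ N : ℕ in atTop, (N : ℝ) ^ a ≤ c * (N : ℝ) ^ b := by
  filter_upwards [(tendsto_natCast_rpow_neg (sub_neg.2 hab)).eventually_le_const hc,
    eventually_gt_atTop 0] with N hN hN0
  have h0 : (0 : ℝ) < N := by exact_mod_cast hN0
  rw [Real.rpow_sub h0, div_le_iff₀ (by positivity)] at hN
  exact hN

lemma eventually_clog_mul_le {κ c : ℝ} (hκ : 0 < κ) (hc : 0 < c) :
    ∀ᶠ N : ℕ in atTop, ((Nat.clog 2 N : ℝ) + 1) * (N : ℝ) ^ (-κ) ≤ c := by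
  have h1 : Tendsto (fun N : ℕ => 2 * (N : ℝ) ^ (-κ) + 4 / κ * (N : ℝ) ^ (-(κ / 2))) atTop
      (𝓝 0) := by
    simpa using ((tendsto_natCast_rpow_neg (neg_neg_of_pos hκ)).const_mul 2).add
      ((tendsto_natCast_rpow_neg (neg_neg_of_pos (half_pos hκ))).const_mul (4 / κ))
  filter_upwards [h1.eventually_le_const hc, eventually_gt_atTop 1] with N hN hN1
  refine le_trans ?_ hN
  have hNR : (1 : ℝ) < N := by exact_mod_cast hN1
  have h2 : (2 : ℝ) ^ (Nat.clog 2 N - 1) < N := by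
    exact_mod_cast Nat.pow_pred_clog_lt_self one_lt_two hN1
  have h3 := Real.log_le_log (by positivity) h2.le
  rw [Real.log_pow] at h3
  have h4 : ((Nat.clog 2 N : ℝ) - 1) ≤ ((Nat.clog 2 N - 1 : ℕ) : ℝ) := by
    have : Nat.clog 2 N ≤ Nat.clog 2 N - 1 + 1 := by omega
    have : (Nat.clog 2 N : ℝ) ≤ ((Nat.clog 2 N - 1 : ℕ) : ℝ) + 1 := by exact_mod_cast this
    linarith
  have h5 := Real.log_two_gt_d9
  have h6 : Real.log N ≤ (N : ℝ) ^ (κ / 2) / (κ / 2) :=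
    Real.log_le_rpow_div (by positivity) (half_pos hκ)
  have h7 : (Nat.clog 2 N : ℝ) + 1 ≤ 2 + 4 / κ * (N : ℝ) ^ (κ / 2) := by
    have h8 : ((Nat.clog 2 N - 1 : ℕ) : ℝ) ≤ 2 * Real.log N := by
      have : (0 : ℝ) ≤ ((Nat.clog 2 N - 1 : ℕ) : ℝ) := by positivity
      nlinarith
    have h9 : (N : ℝ) ^ (κ / 2) / (κ / 2) * 2 = 4 / κ * (N : ℝ) ^ (κ / 2) := by
      field_simp
      ring
    linarith
  have h10 : (N : ℝ) ^ (κ / 2) * (N : ℝ) ^ (-κ) = (N : ℝ) ^ (-(κ / 2)) := by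
    rw [← Real.rpow_add (by positivity)]
    congr 1
    ring
  calc ((Nat.clog 2 N : ℝ) + 1) * (N : ℝ) ^ (-κ)
      ≤ (2 + 4 / κ * (N : ℝ) ^ (κ / 2)) * (N : ℝ) ^ (-κ) := by gcongr
    _ = _ := by rw [add_mul, mul_assoc, h10]

/-- The finite alphabet of frequencies in `{1, …, N}` with dyadic coefficients. -/
def dyadicLetters (N J : ℕ) : Finset (ℤ × ℂ) :=
  ((Finset.Icc 1 (N : ℤ)) ×ˢ (Finset.range (J + 1) ×ˢ Finset.range 4)).image
    fun t => (t.1, (1 / 2 : ℂ) ^ t.2.1 * Complex.I ^ t.2.2)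

lemma card_dyadicLetters_le (N J : ℕ) : (dyadicLetters N J).card ≤ N * ((J + 1) * 4) := by
  refine Finset.card_image_le.trans (le_of_eq ?_)
  simp

lemma mem_dyadicLetters {N J : ℕ} {n : ℤ} (hn : n ∈ Finset.Icc 1 (N : ℤ)) {j d : ℕ} (hj : j ≤ J)
    (hd : d < 4) : (n, (1 / 2 : ℂ) ^ j * Complex.I ^ d) ∈ dyadicLetters N J := by
  refine Finset.mem_image.2 ⟨(n, j, d), ?_, rfl⟩
  simp only [Finset.mem_product, Finset.mem_range]
  exact ⟨hn, by omega, hd⟩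

/-- Dense sets with a bounded `Λ(p)` constant exist for every `p > 2`. -/
lemma exists_dense_lambdaBound {p : ℝ} (hp : 2 < p) :
    ∃ C : ℝ, 0 < C ∧ ∀ᶠ N : ℕ in atTop, ∃ S : Set ℤ, S ⊆ Set.Icc 1 (N : ℤ) ∧
      (4 * p * (N : ℝ)) ^ (2 / p) ≤ (S.ncard : ℝ) ∧ HasLambdaBound S p C := by
  have hp0 : 0 < p := by linarith
  have hp2 : 0 < p - 2 := by linarith
  set α := (p - 2) / 2 with hαd
  have hα : 0 ≤ α := by positivity
  have hpα : 2 * (1 + α) = p := by rw [hαd]; ring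
  set C₁ := 80 * p / (p - 2) with hC₁
  have hC1 : 1 ≤ C₁ := by
    rw [hC₁, le_div_iff₀ hp2]; linarith
  have hC10 : 0 < C₁ := by linarith
  set ε := 1 / (1100 * C₁) with hεd
  have hε : 0 < ε := by positivity
  have hε1 : ε ≤ 1 := by
    rw [hεd, div_le_one (by positivity)]; linarith
  set c₀ := lamConst p with hc₀
  have hc0 : 0 < c₀ := lamConst_pos hp
  refine ⟨25 / 2 * ((2 / ε ^ 2) ^ (1 + α) * Real.exp (wordConst α * ε) +
    2 * c₀ * (2 * c₀) ^ α) ^ (1 / p), by positivity, ?_⟩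
  filter_upwards [exists_random_set hp (2 ^ (1 + α)), eventually_ge_atTop 8,
    eventually_natCast_rpow_le (show 5 / (4 * p) < 3 / (2 * p) by
      rw [div_lt_div_iff₀ (by positivity) (by positivity)]; nlinarith)
      (show (0 : ℝ) < 1 / 6 by norm_num),
    eventually_natCast_rpow_le (show 5 / (4 * p) < 2 / p by
      rw [div_lt_div_iff₀ (by positivity) (by positivity)]; nlinarith)
      (show 0 < c₀ / 6 by positivity),
    eventually_clog_mul_le (κ := (p - 2) / (8 * p)) (by positivity)
      (show 0 < 1 / (800 * C₁) by positivity)] with N hrand hN8 hB1 hB2 hclog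
  have hNR : (8 : ℝ) ≤ N := by exact_mod_cast hN8
  have hN0 : (0 : ℝ) < N := by linarith
  set J := Nat.clog 2 N with hJ
  set Q := (N : ℝ) ^ (3 / (2 * p)) with hQd
  have hQ : 1 ≤ Q := Real.one_le_rpow (by linarith) (by positivity)
  have hQα : Q ^ α = (N : ℝ) ^ (3 * (p - 2) / (4 * p)) := by
    rw [hQd, ← Real.rpow_mul hN0.le, hαd]
    congr 1
    field_simp
    ring
  have hJN : J + 1 ≤ N := by
    have h1 : N ≤ 2 ^ (N - 1) := by
      have := @Nat.lt_two_pow_self (N - 1)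
      omega
    have := Nat.clog_le_of_le_pow h1
    omega
  obtain ⟨S, hSN, hker, hintg⟩ := hrand (ℤ × ℂ) (dyadicLetters N J) J (wordLarge α Q N)
    ((card_dyadicLetters_le N J).trans (by
      calc N * ((J + 1) * 4) ≤ N * (N * N) := by gcongr; omega
        _ = N ^ 3 := by ring)) hJN (fun _ _ => wordLarge_subset)
    (fun L j => by rw [← hQα]; exact card_wordLarge_le hα hQ N L j)
  set δ := lamDensity p N with hδd
  have hδ : 0 ≤ δ := lamDensity_nonneg hp N
  have hδN : δ * N = c₀ * (N : ℝ) ^ (2 / p) := by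
    rw [hδd, lamDensity, mul_assoc, Real.rpow_sub_one hN0.ne', div_mul_cancel₀ _ hN0.ne']
  have hcard : |(S.card : ℝ) - δ * N| ≤ c₀ / 2 * (N : ℝ) ^ (2 / p) := by
    have h1 := hker 0
    have h2 : ∀ T : Finset ℤ, ∑ n ∈ T, fexp n 0 = ((T.card : ℝ) : ℂ) := by
      intro T
      simp [fexp]
    rw [h2, h2, ← Complex.ofReal_mul, ← Complex.ofReal_sub, Complex.norm_real,
      Real.norm_eq_abs] at h1
    simp only [Int.card_Icc, add_sub_cancel_right, Int.toNat_natCast] at h1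
    linarith
  rw [hδN, abs_le] at hcard
  have hNp : 0 < (N : ℝ) ^ (2 / p) := by positivity
  have hM : (S.card : ℝ) ≤ 2 * c₀ * (N : ℝ) ^ (2 / p) := by nlinarith
  have hSle : (S.card : ℝ) ≤ N := by
    have := Finset.card_le_card hSN
    simp only [Int.card_Icc, add_sub_cancel_right, Int.toNat_natCast] at this
    exact_mod_cast this
  have htiny : (S.card : ℝ) * (1 / 4) ^ J ≤ 1 / 8 := by
    have h1 : (N : ℝ) ≤ 2 ^ J := by exact_mod_cast Nat.le_pow_clog one_lt_two N
    have h2 : (1 / 4 : ℝ) ^ J = (1 / 2 ^ J) ^ 2 := by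
      rw [div_pow, div_pow, ← pow_mul, mul_comm J 2, pow_mul]; norm_num
    have h3 : (1 / 2 ^ J : ℝ) ≤ 1 / N := one_div_le_one_div_of_le hN0 h1
    have h4 : (1 / N : ℝ) ≤ 1 / 8 := one_div_le_one_div_of_le (by norm_num) hNR
    calc (S.card : ℝ) * (1 / 4) ^ J ≤ N * (1 / N) ^ 2 := by rw [h2]; gcongr
      _ = 1 / N := by field_simp
      _ ≤ _ := h4
  have hsmall : C₁ * (4 / 3 * ε + (J + 1) * lamSmall p N) ≤ (1 / 20) ^ 2 := by
    have h1 : C₁ * ε = 1 / 1100 := by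
      rw [hεd]; field_simp
    have h2 : C₁ * ((J + 1) * lamSmall p N) ≤ 1 / 800 := by
      calc C₁ * ((J + 1) * lamSmall p N) ≤ C₁ * (1 / (800 * C₁)) := by
            unfold lamSmall; gcongr
        _ = 1 / 800 := by field_simp
    linarith
  have key := trigBound_of_card_wordLarge hα hQ hC1
    (show 0 ≤ lamSmall p N by unfold lamSmall; positivity) hε hε1 hδ (by linarith) hSN hM hker
    (fun n hn j hj d hd => mem_dyadicLetters (hSN hn) hj hd) hintg hsmall htiny
  have hconst : 2 * δ * (2 * c₀ * (N : ℝ) ^ (2 / p)) ^ α = 2 * c₀ * (2 * c₀) ^ α := by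
    have h1 : (N : ℝ) ^ (2 / p - 1) * ((N : ℝ) ^ (2 / p)) ^ α = 1 := by
      rw [← Real.rpow_mul hN0.le, ← Real.rpow_add hN0, hαd,
        show 2 / p - 1 + 2 / p * ((p - 2) / 2) = 0 by field_simp; ring, Real.rpow_zero]
    rw [Real.mul_rpow (by positivity) (by positivity), hδd, lamDensity]
    calc _ = 2 * c₀ * (2 * c₀) ^ α *
          ((N : ℝ) ^ (2 / p - 1) * ((N : ℝ) ^ (2 / p)) ^ α) := by ring
      _ = _ := by rw [h1, mul_one]
  rw [hconst, hpα] at key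
  refine ⟨S, ?_, ?_, key.hasLambdaBound hp0⟩
  · intro n hn
    exact Finset.mem_Icc.1 (hSN hn)
  · rw [Set.ncard_coe_finset, Real.mul_rpow (by positivity) hN0.le]
    have : c₀ = 2 * (4 * p) ^ (2 / p) := rfl
    nlinarith

end DenseSet

lemma fexp_sum {ι : Type*} (s : Finset ι) (t : ι → ℤ) (x : ℝ) :
    fexp (∑ i ∈ s, t i) x = ∏ i ∈ s, fexp (t i) x := by
  unfold fexp
  rw [← Complex.exp_sum, ← Finset.sum_mul, ← Finset.mul_sum]
  push_cast
  rfl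

/-- The even moment of a trigonometric polynomial with frequencies in a `B_m^*[g]` set. -/
lemma integral_norm_trig_pow_le {m g : ℕ} {S : Finset ℤ} (hS : IsBmStarZ m g (S : Set ℤ))
    (a : ℤ → ℂ) :
    ∫ x, ‖trig a S x‖ ^ (2 * m) ∂unitMeasure ≤ g * (∑ n ∈ S, ‖a n‖ ^ 2) ^ m := by
  classical
  set P := Fintype.piFinset fun _ : Fin m => S with hP
  set T := P.image fun t => ∑ i, t i with hT
  set F : ℤ → Finset (Fin m → ℤ) := fun n => P.filter fun t => ∑ i, t i = n with hF
  set c : ℤ → ℂ := fun n => ∑ t ∈ F n, ∏ i, a (t i) with hc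
  have hmaps : ∀ t ∈ P, ∑ i, t i ∈ T := fun t ht => Finset.mem_image_of_mem _ ht
  have hcard : ∀ n, (F n).card ≤ g := by
    intro n
    refine le_trans (le_of_eq ?_) (hS n)
    rw [← Set.ncard_coe_finset]
    congr 1
    ext t
    simp [hF, hP]
  have hpow : ∀ x, trig a S x ^ m = trig c T x := by
    intro x
    unfold trig
    rw [Finset.sum_pow', ← Finset.sum_fiberwise_of_maps_to hmaps]
    refine Finset.sum_congr rfl fun n _ => ?_
    rw [hc, Finset.sum_mul]
    refine Finset.sum_congr rfl fun t ht => ?_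
    rw [Finset.prod_mul_distrib, ← fexp_sum, (Finset.mem_filter.1 ht).2]
  have h1 : ∫ x, ‖trig a S x‖ ^ (2 * m) ∂unitMeasure = ∑ n ∈ T, ‖c n‖ ^ 2 := by
    rw [← integral_norm_trig_sq]
    congr 1
    ext x
    rw [← hpow, norm_pow, ← pow_mul, mul_comm]
  have h2 : ∀ n, ‖c n‖ ^ 2 ≤ g * ∑ t ∈ F n, ∏ i, ‖a (t i)‖ ^ 2 := by
    intro n
    have h3 : ‖c n‖ ≤ ∑ t ∈ F n, 1 * ∏ i, ‖a (t i)‖ := by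
      refine (norm_sum_le _ _).trans (le_of_eq ?_)
      simp
    calc ‖c n‖ ^ 2 ≤ (∑ t ∈ F n, 1 * ∏ i, ‖a (t i)‖) ^ 2 := by gcongr
      _ ≤ (∑ _t ∈ F n, (1 : ℝ) ^ 2) * ∑ t ∈ F n, (∏ i, ‖a (t i)‖) ^ 2 :=
        Finset.sum_mul_sq_le_sq_mul_sq _ _ _
      _ = (F n).card * ∑ t ∈ F n, ∏ i, ‖a (t i)‖ ^ 2 := by simp [Finset.prod_pow]
      _ ≤ _ := by
        have h4 : ((F n).card : ℝ) ≤ g := by exact_mod_cast hcard n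
        have h5 : 0 ≤ ∑ t ∈ F n, ∏ i, ‖a (t i)‖ ^ 2 := by positivity
        gcongr
  rw [h1, Finset.sum_pow', ← Finset.sum_fiberwise_of_maps_to hmaps, Finset.mul_sum]
  exact Finset.sum_le_sum fun n _ => h2 n

lemma IsBmStarZ.trigBound {m g : ℕ} (hm : 0 < m) (hg : 1 ≤ g) {S : Finset ℤ}
    (hS : IsBmStarZ m g (S : Set ℤ)) : TrigBound (2 * m) S g := by
  intro a ha
  have hmR : (0 : ℝ) < m := by exact_mod_cast hm
  have hgR : (1 : ℝ) ≤ g := by exact_mod_cast hg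
  rw [trigNorm_eq (by positivity)]
  have h1 : ∫ x, ‖trig a S x‖ ^ (2 * m : ℝ) ∂unitMeasure ≤ g := by
    have h2 := integral_norm_trig_pow_le hS a
    have h3 : (∑ n ∈ S, ‖a n‖ ^ 2) ^ m ≤ 1 := pow_le_one₀ (by positivity) ha
    have h4 : ∀ x, ‖trig a S x‖ ^ (2 * m : ℝ) = ‖trig a S x‖ ^ (2 * m) := by
      intro x
      rw [← Real.rpow_natCast]
      push_cast
      rfl
    simp only [h4]
    nlinarith
  calc _ ≤ (g : ℝ) ^ (1 / (2 * m : ℝ)) :=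
        Real.rpow_le_rpow (integral_nonneg fun _ => by positivity) h1 (by positivity)
    _ ≤ (g : ℝ) ^ (1 : ℝ) := by
        refine Real.rpow_le_rpow_of_exponent_le hgR ?_
        rw [div_le_one (by positivity)]
        have : (1 : ℝ) ≤ m := by exact_mod_cast hm
        linarith
    _ = g := Real.rpow_one _

/-- If `θ` is not a root of a nonzero polynomial of degree less than `m`, then the `m`-fold
products of linear factors `θ + x` determine their factors. -/
lemma exists_eq_of_prod_add_algebraMap_eq {K L : Type*} [Field K] [Field L] [Algebra K L] {θ : L}
    {m : ℕ} (hθ : ∀ f : Polynomial K, f.degree < m → Polynomial.aeval θ f = 0 → f = 0)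
    {x y : Fin m → K}
    (h : ∏ i, (θ + algebraMap K L (x i)) = ∏ i, (θ + algebraMap K L (y i))) (i : Fin m) :
    ∃ j, x i = y j := by
  have hmon : ∀ z : Fin m → K, (∏ i, (Polynomial.X + Polynomial.C (z i))).Monic := fun z =>
    Polynomial.monic_prod_of_monic _ _ fun i _ => Polynomial.monic_X_add_C _
  have hdeg : ∀ z : Fin m → K, (∏ i, (Polynomial.X + Polynomial.C (z i))).degree =
      (m : WithBot ℕ) := by
    intro z
    rw [Polynomial.degree_prod]
    simp [Polynomial.degree_X_add_C]
  have h1 : (∏ i, (Polynomial.X + Polynomial.C (x i))) -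
      ∏ i, (Polynomial.X + Polynomial.C (y i)) = 0 := by
    refine hθ _ ?_ ?_
    · rw [← hdeg x]
      exact Polynomial.degree_sub_lt_left (by rw [hdeg, hdeg]) (hmon x).ne_zero
        (by rw [(hmon x).leadingCoeff, (hmon y).leadingCoeff])
    · rw [map_sub, map_prod, map_prod]
      simpa [sub_eq_zero] using h
  have h2 := congrArg (Polynomial.eval (-x i)) h1
  rw [Polynomial.eval_sub, Polynomial.eval_prod, Polynomial.eval_prod,
    Finset.prod_eq_zero (Finset.mem_univ i) (by simp), zero_sub, Polynomial.eval_zero,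
    neg_eq_zero, Finset.prod_eq_zero_iff] at h2
  obtain ⟨j, -, hj⟩ := h2
  refine ⟨j, ?_⟩
  simp at hj
  linear_combination -hj

/-- A generator of the unit group of a finite field `L` has full degree over each subfield. -/
lemma eq_zero_of_aeval_generator_eq_zero {K L : Type*} [Field K] [Field L] [Algebra K L]
    [FiniteDimensional K L] {u : Lˣ} (hu : ∀ v, v ∈ Subgroup.zpowers u) {f : Polynomial K}
    (hf : f.degree < Module.finrank K L) (h0 : Polynomial.aeval (u : L) f = 0) : f = 0 := by
  have htop : IntermediateField.adjoin K {(u : L)} = ⊤ := by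
    rw [eq_top_iff]
    rintro x -
    by_cases hx : x = 0
    · rw [hx]
      exact zero_mem _
    · obtain ⟨n, hn⟩ := Set.mem_range.mp (hu (Units.mk0 x hx))
      rw [show x = (u : L) ^ n by norm_cast; rw [hn, Units.val_mk0]]
      exact zpow_mem (IntermediateField.mem_adjoin_simple_self K _) n
  have hintg : IsIntegral K (u : L) := Algebra.IsIntegral.isIntegral _
  have hfin := IntermediateField.adjoin.finrank hintg
  rw [htop, IntermediateField.finrank_top'] at hfin
  by_contra hne
  have h1 := minpoly.degree_le_of_ne_zero K (u : L) hne h0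
  rw [Polynomial.degree_eq_natDegree (minpoly.ne_zero hintg), ← hfin] at h1
  exact absurd hf (not_lt.2 h1)

/-- The periodic extension to `{1, …, M}` of the Bose–Chowla set attached to a unit `u`. -/
def boseChowla (K : Type*) {L : Type*} [Field K] [Field L] [Algebra K L] (u : Lˣ) (M : ℕ) :
    Finset ℤ := by
  classical
  exact (Finset.Icc 1 (M : ℤ)).filter fun s => ∃ x : K, ((u ^ s : Lˣ) : L) = u + algebraMap K L x

lemma mem_boseChowla {K L : Type*} [Field K] [Field L] [Algebra K L] {u : Lˣ} {M : ℕ} {s : ℤ} :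
    s ∈ boseChowla K u M ↔
      (1 ≤ s ∧ s ≤ M) ∧ ∃ x : K, ((u ^ s : Lˣ) : L) = u + algebraMap K L x := by
  classical
  simp [boseChowla]

lemma card_filter_zpow_eq_le {G : Type*} [Group G] [DecidableEq G] {u : G} {q : ℕ}
    (hq : 0 < q) (hord : orderOf u = q) (k : ℕ) (v : G) :
    ((Finset.Icc 1 ((k * q : ℕ) : ℤ)).filter fun s => u ^ s = v).card ≤ k := by
  have hqZ : (0 : ℤ) < q := by exact_mod_cast hq
  refine (Finset.card_le_card_of_injOn (t := Finset.range k)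
    (fun s : ℤ => ((s - 1) / q).toNat) ?_ ?_).trans_eq (Finset.card_range k)
  · intro s hs
    simp only [Finset.coe_filter, Finset.mem_Icc, Set.mem_ofPred_eq] at hs
    have h1 : (s - 1) / q < k := by
      rw [Int.ediv_lt_iff_lt_mul hqZ]
      have := hs.1.2
      push_cast at this
      linarith
    have h2 : 0 ≤ (s - 1) / q := Int.ediv_nonneg (by linarith [hs.1.1]) hqZ.le
    simp only [Finset.coe_range, Set.mem_Iio]
    omega
  · intro s hs t ht hst
    simp only [Finset.coe_filter, Finset.mem_Icc, Set.mem_ofPred_eq] at hs ht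
    have h1 : 0 ≤ (s - 1) / q := Int.ediv_nonneg (by linarith [hs.1.1]) hqZ.le
    have h2 : 0 ≤ (t - 1) / q := Int.ediv_nonneg (by linarith [ht.1.1]) hqZ.le
    have h3 : (s - 1) / q = (t - 1) / q := by
      simp only at hst
      omega
    have h4 : s ≡ t [ZMOD q] := by
      rw [← hord, ← zpow_eq_zpow_iff_modEq, hs.2, ht.2]
    have h5 : (s - 1) % q = (t - 1) % q := h4.sub_right 1
    have h6 := Int.mul_ediv_add_emod (s - 1) q
    have h7 := Int.mul_ediv_add_emod (t - 1) q
    rw [h3, h5] at h6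
    linarith

lemma prod_zpow_eq_zpow_sum {ι G : Type*} [CommGroup G] (u : G) (s : Finset ι) (t : ι → ℤ) :
    ∏ i ∈ s, u ^ t i = u ^ ∑ i ∈ s, t i := by
  classical
  induction s using Finset.induction_on with
  | empty => simp
  | insert i s hi ih => rw [Finset.prod_insert hi, Finset.sum_insert hi, zpow_add, ih]

lemma isBmStarZ_boseChowla {K L : Type*} [Field K] [Field L] [Algebra K L] {u : Lˣ} {m k q : ℕ}
    (hq : 0 < q) (hord : orderOf u = q)
    (hu : ∀ f : Polynomial K, f.degree < m → Polynomial.aeval (u : L) f = 0 → f = 0) :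
    IsBmStarZ m ((m * k) ^ m) (boseChowla K u (k * q) : Set ℤ) := by
  classical
  intro n
  rcases Set.eq_empty_or_nonempty
    {t : Fin m → ℤ | (∀ i, t i ∈ (boseChowla K u (k * q) : Set ℤ)) ∧ ∑ i, t i = n} with h | ⟨r, hr⟩
  · rw [h]
    simp
  set D : Finset ℤ := Finset.univ.biUnion fun j : Fin m =>
    (Finset.Icc 1 ((k * q : ℕ) : ℤ)).filter fun s => u ^ s = u ^ r j with hD
  have hDcard : D.card ≤ m * k := by
    refine (Finset.card_biUnion_le_card_mul _ _ k fun j _ =>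
      card_filter_zpow_eq_le hq hord k _).trans_eq ?_
    simp
  have hsub : {t : Fin m → ℤ | (∀ i, t i ∈ (boseChowla K u (k * q) : Set ℤ)) ∧ ∑ i, t i = n} ⊆
      (Fintype.piFinset fun _ : Fin m => D : Finset (Fin m → ℤ)) := by
    intro t ht
    have ht1 := fun i => mem_boseChowla.1 (Finset.mem_coe.1 (ht.1 i))
    have hr1 := fun i => mem_boseChowla.1 (Finset.mem_coe.1 (hr.1 i))
    choose x hx using fun i => (ht1 i).2
    choose y hy using fun i => (hr1 i).2
    have hprod : ∏ i, ((u : L) + algebraMap K L (x i)) = ∏ i, ((u : L) + algebraMap K L (y i)) := by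
      simp only [← hx, ← hy]
      have hz : ∀ s : Fin m → ℤ, ∏ i, ((u ^ s i : Lˣ) : L) = ((u ^ ∑ i, s i : Lˣ) : L) := by
        intro s
        rw [← Units.coe_prod]
        congr 1
        exact prod_zpow_eq_zpow_sum u _ s
      rw [hz, hz, ht.2, hr.2]
    rw [Finset.mem_coe, Fintype.mem_piFinset]
    intro i
    obtain ⟨j, hj⟩ := exists_eq_of_prod_add_algebraMap_eq hu hprod i
    rw [hD, Finset.mem_biUnion]
    refine ⟨j, Finset.mem_univ _, Finset.mem_filter.2 ⟨Finset.mem_Icc.2 (ht1 i).1, ?_⟩⟩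
    ext
    rw [hx, hy, hj]
  refine (Set.ncard_le_ncard hsub (Finset.finite_toSet _)).trans ?_
  rw [Set.ncard_coe_finset, Fintype.card_piFinset]
  simpa using Nat.pow_le_pow_left hDcard m

lemma le_card_boseChowla {K L : Type*} [Field K] [Fintype K] [Field L] [Algebra K L] {u : Lˣ}
    {q : ℕ} (k : ℕ) (hq : 0 < q) (hord : orderOf u = q) (hgen : ∀ v, v ∈ Subgroup.zpowers u)
    (hu : ∀ x : K, (u : L) + algebraMap K L x ≠ 0) :
    Fintype.card K * k ≤ (boseChowla K u (k * q)).card := by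
  have hqZ : (0 : ℤ) < q := by exact_mod_cast hq
  have hex : ∀ x : K, ∃ e : ℤ, (0 ≤ e ∧ e < q) ∧
      ((u ^ (e + 1) : Lˣ) : L) = u + algebraMap K L x := by
    intro x
    obtain ⟨n, hn⟩ := Set.mem_range.mp (hgen (Units.mk0 _ (hu x)))
    refine ⟨(n - 1) % q, ⟨Int.emod_nonneg _ hqZ.ne', Int.emod_lt_of_pos _ hqZ⟩, ?_⟩
    have h1 : u ^ ((n - 1) % q + 1) = u ^ n := by
      rw [zpow_eq_zpow_iff_modEq, hord]
      simpa using (Int.mod_modEq (n - 1) q).add_right 1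
    rw [h1]
    rw [hn, Units.val_mk0]
  choose e he1 he2 using hex
  have hpow : ∀ (x : K) (i : ℕ), u ^ (e x + 1 + i * q) = u ^ (e x + 1) := by
    intro x i
    rw [zpow_eq_zpow_iff_modEq, hord]
    exact Int.modEq_iff_dvd.2 ⟨-i, by ring⟩
  have hcard : (Finset.univ ×ˢ Finset.range k : Finset (K × ℕ)).card = Fintype.card K * k := by
    simp
  rw [← hcard]
  refine Finset.card_le_card_of_injOn (fun z => e z.1 + 1 + z.2 * q) ?_ ?_
  · rintro ⟨x, i⟩ hz
    simp only [Finset.coe_product, Set.mem_prod, Finset.mem_coe, Finset.mem_range] at hz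
    have hik : (i : ℤ) + 1 ≤ k := by exact_mod_cast hz.2
    simp only [Finset.mem_coe]
    refine mem_boseChowla.2 ⟨⟨?_, ?_⟩, x, ?_⟩
    · have : 0 ≤ (i : ℤ) * q := by positivity
      linarith [(he1 x).1]
    · push_cast
      nlinarith [(he1 x).2]
    · rw [hpow, he2]
  · rintro ⟨x, i⟩ - ⟨y, j⟩ - hz
    simp only at hz
    have hxy : x = y := by
      have h1 := he2 x
      rw [← hpow x i, hz, hpow, he2] at h1
      exact ((algebraMap K L).injective (add_left_cancel h1)).symm
    subst hxy
    have h2 : (i : ℤ) * q = j * q := by linarith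
    have h3 : (i : ℤ) = j := mul_right_cancel₀ hqZ.ne' h2
    rw [Prod.mk.injEq]
    exact ⟨rfl, by exact_mod_cast h3⟩

/-- Periodized Bose–Chowla sets. -/
lemma exists_boseChowla (ℓ m k : ℕ) (hℓ : ℓ.Prime) (hm : 2 ≤ m) :
    ∃ S : Finset ℤ, S ⊆ Finset.Icc 1 ((k * ℓ ^ m : ℕ) : ℤ) ∧ ℓ * k ≤ S.card ∧
      IsBmStarZ m ((m * k) ^ m) (S : Set ℤ) := by
  have : Fact ℓ.Prime := ⟨hℓ⟩
  have hm0 : m ≠ 0 := by omega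
  set L := GaloisField ℓ m
  obtain ⟨u, hu⟩ := IsCyclic.exists_generator (α := Lˣ)
  have hrank : Module.finrank (ZMod ℓ) L = m := GaloisField.finrank ℓ hm0
  have hord : orderOf u = ℓ ^ m - 1 := by
    rw [orderOf_eq_card_of_forall_mem_zpowers hu, Nat.card_units, GaloisField.card ℓ m hm0]
  have hq : 0 < ℓ ^ m - 1 := by
    have := Nat.one_lt_pow hm0 hℓ.one_lt
    omega
  have hmin : ∀ f : Polynomial (ZMod ℓ), f.degree < m → Polynomial.aeval (u : L) f = 0 → f = 0 :=
    fun f hf h0 => eq_zero_of_aeval_generator_eq_zero hu (by rwa [hrank]) h0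
  have hne : ∀ x : ZMod ℓ, (u : L) + algebraMap (ZMod ℓ) L x ≠ 0 := by
    intro x hx
    refine (Polynomial.monic_X_add_C x).ne_zero (hmin _ ?_ (by simpa using hx))
    rw [Polynomial.degree_X_add_C]
    exact_mod_cast hm
  refine ⟨boseChowla (ZMod ℓ) u (k * (ℓ ^ m - 1)), ?_, ?_, isBmStarZ_boseChowla hq hord hmin⟩
  · intro s hs
    have h1 := (mem_boseChowla.1 hs).1
    refine Finset.mem_Icc.2 ⟨h1.1, h1.2.trans ?_⟩
    exact_mod_cast Nat.mul_le_mul_left k (Nat.sub_le _ _)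
  · simpa using le_card_boseChowla (K := ZMod ℓ) k hq hord hu hne

lemma exists_prime_mul_pow_le {m k N : ℕ} (hm : 2 ≤ m) (hk : 0 < k) (hN : k * 2 ^ m ≤ N) :
    ∃ ℓ : ℕ, ℓ.Prime ∧ k * ℓ ^ m ≤ N ∧ N ≤ k * (2 * ℓ) ^ m := by
  have hex : ∃ n, N < k * (2 * (n + 1)) ^ m := by
    refine ⟨N, ?_⟩
    calc N < 2 * (N + 1) := by omega
      _ ≤ (2 * (N + 1)) ^ m := Nat.le_self_pow (by omega) _
      _ ≤ k * (2 * (N + 1)) ^ m := Nat.le_mul_of_pos_left _ hk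
  classical
  set n := Nat.find hex with hn
  have h1 : N < k * (2 * (n + 1)) ^ m := Nat.find_spec hex
  have hn0 : n ≠ 0 := by
    intro h
    rw [h] at h1
    simp at h1
    omega
  have h2 : k * (2 * n) ^ m ≤ N := by
    have := Nat.find_min hex (m := n - 1) (by omega)
    rw [Nat.sub_add_cancel (by omega)] at this
    exact not_lt.1 this
  obtain ⟨ℓ, hℓ, h3, h4⟩ := Nat.exists_prime_lt_and_le_two_mul n hn0
  refine ⟨ℓ, hℓ, le_trans ?_ h2, h1.le.trans ?_⟩
  · gcongr
  · gcongr
    omega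

lemma exists_dense_isBmStarZ {m : ℕ} (hm : 2 ≤ m) : ∃ g : ℕ, 1 ≤ g ∧ ∃ C : ℝ, 0 < C ∧
    ∃ N₀ : ℕ, ∀ N : ℕ, N₀ ≤ N → ∃ S : Set ℤ, S ⊆ Set.Icc 1 (N : ℤ) ∧
      (4 * (2 * (m : ℝ)) * (N : ℝ)) ^ (2 / (2 * (m : ℝ))) ≤ (S.ncard : ℝ) ∧
      HasLambdaBound S (2 * m) C ∧ IsBmStarZ m g S := by
  set k := 8 * m * 2 ^ m with hk
  have hk0 : 0 < k := by positivity
  have hg : 1 ≤ (m * k) ^ m := Nat.one_le_pow _ _ (by positivity)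
  have hmR : (0 : ℝ) < m := by
    have : 0 < m := by omega
    exact_mod_cast this
  refine ⟨(m * k) ^ m, hg, ((m * k) ^ m : ℕ), by exact_mod_cast hg, k * 2 ^ m, fun N hN => ?_⟩
  obtain ⟨ℓ, hℓ, h1, h2⟩ := exists_prime_mul_pow_le hm hk0 hN
  obtain ⟨S, hS1, hS2, hS3⟩ := exists_boseChowla ℓ m k hℓ hm
  refine ⟨S, fun s hs => ?_, ?_,
    (hS3.trigBound (by omega) hg).hasLambdaBound (by positivity), hS3⟩
  · have h3 := Finset.mem_Icc.1 (hS1 hs)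
    exact ⟨h3.1, h3.2.trans (by exact_mod_cast h1)⟩
  · have h3 : 8 * m * N ≤ (ℓ * k) ^ m := by
      calc 8 * m * N ≤ 8 * m * (k * (2 * ℓ) ^ m) := by gcongr
        _ = k ^ 2 * ℓ ^ m := by rw [mul_pow, hk]; ring
        _ ≤ k ^ m * ℓ ^ m := by gcongr
        _ = (ℓ * k) ^ m := by rw [← mul_pow, mul_comm ℓ]
    have h4 : 4 * (2 * (m : ℝ)) * N ≤ ((ℓ * k : ℕ) : ℝ) ^ m := by
      have : ((8 * m * N : ℕ) : ℝ) ≤ (((ℓ * k) ^ m : ℕ) : ℝ) := by exact_mod_cast h3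
      push_cast at this ⊢
      linarith
    rw [Set.ncard_coe_finset]
    calc _ ≤ (((ℓ * k : ℕ) : ℝ) ^ m) ^ (2 / (2 * (m : ℝ))) := by gcongr
      _ = ((ℓ * k : ℕ) : ℝ) := by
        rw [← Real.rpow_natCast, ← Real.rpow_mul (by positivity),
          show (m : ℝ) * (2 / (2 * m)) = 1 by field_simp, Real.rpow_one]
      _ ≤ S.card := by exact_mod_cast hS2

/-- For every `p > 2` there is `C_p > 0` such that for all sufficiently large `N` there
exists `S_N ⊆ {1, …, N}` with `card(S_N) ≥ (4pN)^{2/p}` and `‖S_N‖_{Λ(p)} ≤ C_p`.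
Moreover, when `p = 2m` with `m ≥ 2` an integer, `S_N` can additionally be taken to be a
`B_m^*[g]` set for some `g ≥ 1` depending only on `m`. -/
theorem lambda_p_dense_set :
    (∀ p : ℝ, 2 < p → ∃ C : ℝ, 0 < C ∧ ∃ N₀ : ℕ, ∀ N : ℕ, N₀ ≤ N →
      ∃ S : Set ℤ, S ⊆ Set.Icc 1 (N : ℤ) ∧
        (4 * p * (N : ℝ)) ^ (2 / p) ≤ (S.ncard : ℝ) ∧
        HasLambdaBound S p C) ∧
    (∀ m : ℕ, 2 ≤ m → ∃ g : ℕ, 1 ≤ g ∧ ∃ C : ℝ, 0 < C ∧ ∃ N₀ : ℕ, ∀ N : ℕ, N₀ ≤ N →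
      ∃ S : Set ℤ, S ⊆ Set.Icc 1 (N : ℤ) ∧
        (4 * (2 * (m : ℝ)) * (N : ℝ)) ^ (2 / (2 * (m : ℝ))) ≤ (S.ncard : ℝ) ∧
        HasLambdaBound S (2 * m) C ∧ IsBmStarZ m g S) := by
  refine ⟨fun p hp => ?_, fun m hm => exists_dense_isBmStarZ hm⟩
  obtain ⟨C, hC, h⟩ := exists_dense_lambdaBound hp
  exact ⟨C, hC, Filter.eventually_atTop.1 h⟩
end
end

section
/- Let m ≥ 2 be an integer and g ≥ 1. Let 𝓘 be a finite family of closed subintervals of [−1/2,1/2], all of common length λ ∈ (0,1), such that for every y ∈ ℝ the number of m-tuples (I₁,…,I_m) ∈ 𝓘^m with y ∈ I₁ + ⋯ + I_m (Minkowski sum) is at most g. Let (𝓘_k)_{k≥1} be the Cantor iteration generated by 𝓘. Then for every k ≥ 1 and every y ∈ ℝ, the number of m-tuples (I₁,…,I_m) ∈ 𝓘_k^m with y ∈ I₁ + ⋯ + I_m is at most g^k. -/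
open Set MeasureTheory
open scoped BigOperators Real

noncomputable section

/-- The Cantor iteration generated by a family of intervals of common length `lam`,
represented by the finset `S` of their left endpoints.  `cantorIter lam S k` is the set
of left endpoints of the intervals of the `(k+1)`-st level `𝓘_{k+1}`; these intervals
have length `lam^(k+1)`.  A level-`(k+1)` interval `I = [a, a + lam^(k+1)]` gives rise to
the level-`(k+2)` intervals `L_I⁻¹([b, b + lam])`, of left endpoint
`a + lam^(k+1) (b + 1/2)`, where `L_I` is the increasing affine bijection from `I` onto
`[-1/2, 1/2]` and `b ∈ S`. -/
def cantorIter (lam : ℝ) (S : Finset ℝ) : ℕ → Finset ℝ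
  | 0 => S
  | k + 1 =>
    @Finset.image _ _ (Classical.decEq ℝ)
      (fun ab => ab.1 + lam ^ (k + 1) * (ab.2 + 1 / 2)) (cantorIter lam S k ×ˢ S)

/-- A real number is a sum of points of the intervals `[t i, t i + L]` iff it lies in the
Minkowski sum `[∑ t i, ∑ t i + m L]`. -/
theorem exists_mem_Icc_sum_eq_iff {m : ℕ} (hm : m ≠ 0) (t : Fin m → ℝ) (L y : ℝ) :
    (∃ x : Fin m → ℝ, (∀ i, x i ∈ Set.Icc (t i) (t i + L)) ∧ ∑ i, x i = y) ↔
      ∑ i, t i ≤ y ∧ y ≤ ∑ i, t i + m * L := by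
  constructor
  · rintro ⟨x, hx, rfl⟩
    refine ⟨Finset.sum_le_sum fun i _ => (hx i).1, ?_⟩
    have h := Finset.sum_le_sum fun i (_ : i ∈ Finset.univ) => (hx i).2
    simpa [Finset.sum_add_distrib] using h
  · rintro ⟨h₁, h₂⟩
    have hm' : (0 : ℝ) < m := by positivity
    refine ⟨fun i => t i + (y - ∑ j, t j) / m, fun i => ⟨?_, ?_⟩, ?_⟩
    · have : 0 ≤ (y - ∑ j, t j) / m := div_nonneg (by linarith) hm'.le
      linarith
    · have : (y - ∑ j, t j) / m ≤ L := by
        rw [div_le_iff₀ hm']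
        linarith
      linarith
    · simp only [Finset.sum_add_distrib, Finset.sum_const, Finset.card_univ, Fintype.card_fin,
        nsmul_eq_mul]
      field_simp
      ring

/-- The tuples with entries in a finset that satisfy a predicate form a finite set. -/
theorem finite_setOf_forall_mem_and {m : ℕ} (S : Finset ℝ) (p : (Fin m → ℝ) → Prop) :
    {t : Fin m → ℝ | (∀ i, t i ∈ S) ∧ p t}.Finite :=
  (Set.Finite.pi' fun _ => S.finite_toSet).subset fun _ ht => ht.1

/-- If every point of `ℝ` lies in at most `g` of the `m`-fold Minkowski sums of the
first-level intervals `[a, a + lam]`, `a ∈ S`, then for every level `k ≥ 1` every point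
of `ℝ` lies in at most `g^k` of the `m`-fold Minkowski sums of the level-`k` intervals of
the Cantor iteration.  (Here level `k` is `cantorIter lam S (k-1)`, with intervals of
length `lam^k`; the statement is phrased for all levels `k + 1`, `k : ℕ`.) -/
theorem cantor_overlap (m g : ℕ) (hm : 2 ≤ m) (hg : 1 ≤ g)
    (lam : ℝ) (hlam : lam ∈ Set.Ioo (0 : ℝ) 1) (S : Finset ℝ)
    (hS : ∀ a ∈ S, Set.Icc a (a + lam) ⊆ Set.Icc (-(1 / 2) : ℝ) (1 / 2))
    (hover : ∀ y : ℝ, Set.ncard {t : Fin m → ℝ | (∀ i, t i ∈ S) ∧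
      ∃ x : Fin m → ℝ, (∀ i, x i ∈ Set.Icc (t i) (t i + lam)) ∧ ∑ i, x i = y} ≤ g) :
    ∀ k : ℕ, ∀ y : ℝ,
      Set.ncard {t : Fin m → ℝ | (∀ i, t i ∈ cantorIter lam S k) ∧
        ∃ x : Fin m → ℝ, (∀ i, x i ∈ Set.Icc (t i) (t i + lam ^ (k + 1))) ∧
          ∑ i, x i = y} ≤ g ^ (k + 1) := by
  have hm₀ : m ≠ 0 := by omega
  obtain ⟨hlam₀, hlam₁⟩ := hlam
  simp only [exists_mem_Icc_sum_eq_iff hm₀] at hover ⊢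
  intro k
  induction k with
  | zero => simpa [cantorIter] using hover
  | succ k ih =>
    intro y
    classical
    have hL : 0 < lam ^ (k + 1) := pow_pos hlam₀ _
    set A := {t : Fin m → ℝ | (∀ i, t i ∈ cantorIter lam S k) ∧
      ∑ i, t i ≤ y ∧ y ≤ ∑ i, t i + m * lam ^ (k + 1)}
    have hAfin : A.Finite := finite_setOf_forall_mem_and _ _
    let B : (Fin m → ℝ) → Set (Fin m → ℝ) := fun a => {b | (∀ i, b i ∈ S) ∧
      ∑ i, b i ≤ (y - ∑ i, a i) / lam ^ (k + 1) - m / 2 ∧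
      (y - ∑ i, a i) / lam ^ (k + 1) - m / 2 ≤ ∑ i, b i + m * lam}
    have hBfin : ∀ a, (B a).Finite := fun a => finite_setOf_forall_mem_and _ _
    let F : Finset (Fin m → ℝ) := hAfin.toFinset.biUnion fun a =>
      (hBfin a).toFinset.image fun b i => a i + lam ^ (k + 1) * (b i + 1 / 2)
    have hF : F.card ≤ g ^ (k + 1) * g := by
      refine (Finset.card_biUnion_le_card_mul _ _ g fun a _ => ?_).trans
        (Nat.mul_le_mul_right g ?_)
      · exact Finset.card_image_le.trans
          ((Set.ncard_eq_toFinset_card _ (hBfin a)).symm.le.trans (hover _))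
      · exact (Set.ncard_eq_toFinset_card _ hAfin).symm.le.trans (ih y)
    rw [← Set.ncard_coe_finset F, ← pow_succ] at hF
    refine (Set.ncard_le_ncard ?_ F.finite_toSet).trans hF
    rintro t ⟨ht, h₁, h₂⟩
    simp only [cantorIter, Finset.mem_image, Finset.mem_product, Prod.exists] at ht
    choose a b hab ht using ht
    obtain rfl : (fun i => a i + lam ^ (k + 1) * (b i + 1 / 2)) = t := funext ht
    have hsum : ∑ i, (a i + lam ^ (k + 1) * (b i + 1 / 2)) =
        ∑ i, a i + lam ^ (k + 1) * (∑ i, b i + m / 2) := by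
      simp only [Finset.sum_add_distrib, ← Finset.mul_sum, Finset.sum_const, Finset.card_univ,
        Fintype.card_fin, nsmul_eq_mul]
      ring
    rw [hsum] at h₁ h₂
    have hb₁ : -(m / 2 : ℝ) ≤ ∑ i, b i := by
      have h := Finset.sum_le_sum fun i (_ : i ∈ Finset.univ) =>
        (hS _ (hab i).2 (Set.left_mem_Icc.2 (by linarith))).1
      simp only [Finset.sum_const, Finset.card_univ, Fintype.card_fin, nsmul_eq_mul] at h
      linarith
    have hb₂ : ∑ i, b i + m * lam ≤ m / 2 := by
      have h := Finset.sum_le_sum fun i (_ : i ∈ Finset.univ) =>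
        (hS _ (hab i).2 (Set.right_mem_Icc.2 (by linarith))).2
      simp only [Finset.sum_add_distrib, Finset.sum_const, Finset.card_univ, Fintype.card_fin,
        nsmul_eq_mul] at h
      linarith
    rw [pow_succ lam (k + 1)] at h₂
    simp only [F, Finset.coe_biUnion, Finset.coe_image, Set.Finite.coe_toFinset, Set.mem_iUnion]
    refine ⟨a, ⟨fun i => (hab i).1, ?_, ?_⟩, b, ⟨fun i => (hab i).2, ?_, ?_⟩, rfl⟩
    · nlinarith [mul_nonneg hL.le (by linarith : 0 ≤ ∑ i, b i + m / 2)]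
    · nlinarith [mul_le_mul_of_nonneg_left hb₂ hL.le]
    · rw [le_sub_iff_add_le, le_div_iff₀ hL]
      linarith
    · rw [sub_le_iff_le_add, div_le_iff₀ hL]
      linarith
end
end
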